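/- arXiv:1308.6761 — 10 statements merged into one kernel-verified Lean document; each statement's English description precedes it below -/
import Mathlib

section
/- A collection {P(X_i): i ∈ I} of extended-real-valued marginal previsions for random variables X_i: Ω → ℝ is extended-coherent if and only if it is coherent₁. -/
open scoped BigOperators

noncomputable section

/-- The indicator function of an event `B`, as a real-valued random variable. -/
def indicatorRV {Ω : Type*} (B : Set Ω) : Ω → ℝ := B.indicator fun _ => 1

/-- De Finetti-style coherence₁ for a collection of conditional previsions
`P (X i | B i)`, allowing infinite previsions.  For every finite subcollection,
all real coefficients `α j` (nonnegative where the prevision is `⊤`, nonpositive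
where it is `⊥`), and all real prices `c j` that agree with the prevision wherever
it is finite, the resulting acceptable gamble has nonnegative supremum. -/
def Coherent1 {Ω I : Type*} (X : I → Ω → ℝ) (B : I → Set Ω) (P : I → EReal) : Prop :=
  ∀ (n : ℕ) (idx : Fin n → I) (α c : Fin n → ℝ),
    (∀ j, P (idx j) = ⊤ → 0 ≤ α j) →
    (∀ j, P (idx j) = ⊥ → α j ≤ 0) →
    (∀ j, P (idx j) ≠ ⊤ → P (idx j) ≠ ⊥ → (c j : EReal) = P (idx j)) →
    0 ≤ ⨆ ω, ((∑ j, α j * indicatorRV (B (idx j)) ω * (X (idx j) ω - c j) : ℝ) : EReal)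

/-- Extended coherence in the sense of Crisma, Gigante and Millossovich for
marginal previsions: for every finite subcollection and all real coefficients
such that all infinite terms `α j * P (X (idx j))` have the same sign, the sum
`∑ j, α j * P (X (idx j))` lies between the infimum and the supremum of
`∑ j, α j * X (idx j) ω`. -/
def ExtCoherent {Ω I : Type*} (X : I → Ω → ℝ) (P : I → EReal) : Prop :=
  ∀ (n : ℕ) (idx : Fin n → I) (α : Fin n → ℝ),
    ((∀ j, (α j : EReal) * P (idx j) ≠ ⊤) ∨ (∀ j, (α j : EReal) * P (idx j) ≠ ⊥)) →
    (⨅ ω, ((∑ j, α j * X (idx j) ω : ℝ) : EReal)) ≤ ∑ j, (α j : EReal) * P (idx j) ∧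
      ∑ j, (α j : EReal) * P (idx j) ≤ ⨆ ω, ((∑ j, α j * X (idx j) ω : ℝ) : EReal)

theorem EReal.sum_eq_bot_of_mem {ι : Type*} {s : Finset ι} {f : ι → EReal} {i : ι}
    (hi : i ∈ s) (h : f i = ⊥) : ∑ j ∈ s, f j = ⊥ := by
  classical
  rw [← Finset.add_sum_erase s f hi, h, EReal.bot_add]

theorem EReal.sum_ne_bot {ι : Type*} {s : Finset ι} {f : ι → EReal}
    (h : ∀ i, f i ≠ ⊥) : ∑ j ∈ s, f j ≠ ⊥ := by
  classical
  induction s using Finset.induction_on with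
  | empty => simp
  | insert a s ha ih =>
    rw [Finset.sum_insert ha]
    simp [EReal.add_eq_bot_iff, h a, ih]

theorem EReal.sum_neg_of_ne_bot {ι : Type*} {s : Finset ι} {f : ι → EReal}
    (h : ∀ i, f i ≠ ⊥) : ∑ j ∈ s, -f j = -∑ j ∈ s, f j := by
  classical
  induction s using Finset.induction_on with
  | empty => simp
  | insert a s ha ih =>
    rw [Finset.sum_insert ha, Finset.sum_insert ha, ih,
      EReal.neg_add (.inl (h a)) (.inr (EReal.sum_ne_bot h)), sub_eq_add_neg]

theorem EReal.sum_neg_of_ne_top {ι : Type*} {s : Finset ι} {f : ι → EReal}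
    (h : ∀ i, f i ≠ ⊤) : ∑ j ∈ s, -f j = -∑ j ∈ s, f j := by
  have key := EReal.sum_neg_of_ne_bot (s := s) (f := fun j => -f j)
    (fun i => by simpa [EReal.neg_eq_bot_iff] using h i)
  simp only [neg_neg] at key
  rw [key, neg_neg]

theorem EReal.neg_iSup_neg {ι : Type*} (f : ι → EReal) : -⨆ i, -f i = ⨅ i, f i := by
  apply le_antisymm
  · exact le_iInf fun i => EReal.neg_le_of_neg_le (le_iSup (fun i => -f i) i)
  · exact EReal.le_neg_of_le_neg (iSup_le fun i => EReal.neg_le_neg_iff.2 (iInf_le f i))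

theorem EReal.zero_le_iSup_sub_iff {ι : Type*} [Nonempty ι] (f : ι → ℝ) (k : ℝ) :
    0 ≤ ⨆ i, ((f i - k : ℝ) : EReal) ↔ (k : EReal) ≤ ⨆ i, (f i : EReal) := by
  have key (g : ι → ℝ) (a : ℝ) :
      (a : EReal) ≤ ⨆ i, (g i : EReal) ↔ ∀ b : ℝ, (∀ i, g i ≤ b) → a ≤ b := by
    rw [le_iSup_iff]
    constructor
    · intro h b hb
      exact_mod_cast h b fun i => by exact_mod_cast hb i
    · intro h b hb
      induction b with
      | bot => simpa using hb (Classical.arbitrary ι)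
      | top => exact le_top
      | coe b => exact_mod_cast h b fun i => by exact_mod_cast hb i
  rw [← EReal.coe_zero, key, key]
  constructor
  · intro h b hb
    linarith [h (b - k) fun i => by linarith [hb i]]
  · intro h b hb
    linarith [h (b + k) fun i => by linarith [hb i]]

/-- With `B = Ω`, a gamble's supremum is nonnegative iff its total price is at most the
supremum of the corresponding combination of random variables. -/
theorem zero_le_iSup_gamble_iff {Ω ι : Type*} [Nonempty Ω] [Fintype ι]
    (X : ι → Ω → ℝ) (α c : ι → ℝ) :
    0 ≤ ⨆ ω, ((∑ j, α j * indicatorRV Set.univ ω * (X j ω - c j) : ℝ) : EReal) ↔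
      ((∑ j, α j * c j : ℝ) : EReal) ≤ ⨆ ω, ((∑ j, α j * X j ω : ℝ) : EReal) := by
  rw [← EReal.zero_le_iSup_sub_iff]
  simp [indicatorRV, mul_sub, Finset.sum_sub_distrib]

theorem EReal.coe_mul_ne_bot_iff (a : ℝ) (p : EReal) :
    (a : EReal) * p ≠ ⊥ ↔ (p = ⊤ → 0 ≤ a) ∧ (p = ⊥ → a ≤ 0) := by
  rw [Ne, EReal.mul_eq_bot]
  induction p <;> simp

theorem EReal.sum_coe_mul_coe {ι : Type*} (s : Finset ι) (a b : ι → ℝ) :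
    ∑ j ∈ s, (a j : EReal) * (b j : EReal) = ((∑ j ∈ s, a j * b j : ℝ) : EReal) := by
  simp only [← EReal.coe_mul]
  exact (map_sum (⟨⟨Real.toEReal, EReal.coe_zero⟩, EReal.coe_add⟩ : ℝ →+ EReal) _ _).symm

theorem Coherent1.sum_le_iSup {Ω I : Type*} [Nonempty Ω] {X : I → Ω → ℝ} {P : I → EReal}
    (h : Coherent1 X (fun _ => (Set.univ : Set Ω)) P) {n : ℕ} (idx : Fin n → I)
    (α : Fin n → ℝ) (hα : ∀ j, (α j : EReal) * P (idx j) ≠ ⊥) :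
    ∑ j, (α j : EReal) * P (idx j) ≤ ⨆ ω, ((∑ j, α j * X (idx j) ω : ℝ) : EReal) := by
  have price_le (c : Fin n → ℝ)
      (hc : ∀ j, P (idx j) ≠ ⊤ → P (idx j) ≠ ⊥ → (c j : EReal) = P (idx j)) :
      ((∑ j, α j * c j : ℝ) : EReal) ≤ ⨆ ω, ((∑ j, α j * X (idx j) ω : ℝ) : EReal) :=
    (zero_le_iSup_gamble_iff _ α c).1 <| h n idx α c
      (fun j => ((EReal.coe_mul_ne_bot_iff _ _).1 (hα j)).1)
      (fun j => ((EReal.coe_mul_ne_bot_iff _ _).1 (hα j)).2) hc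
  have toReal_spec (j : Fin n) (h₁ : P (idx j) ≠ ⊤) (h₂ : P (idx j) ≠ ⊥) :
      ((P (idx j)).toReal : EReal) = P (idx j) := EReal.coe_toReal h₁ h₂
  by_cases hfin : ∃ j, α j ≠ 0 ∧ (P (idx j) = ⊤ ∨ P (idx j) = ⊥)
  · obtain ⟨i, hi, hP⟩ := hfin
    -- The price at `i` is unconstrained, so the total price can be any real number.
    suffices hsup : (⨆ ω, ((∑ j, α j * X (idx j) ω : ℝ) : EReal)) = ⊤ from hsup ▸ le_top
    refine EReal.eq_top_iff_forall_lt _ |>.2 fun r => ?_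
    let c : ℝ → Fin n → ℝ := fun t => Function.update (fun j => (P (idx j)).toReal) i t
    let rest : ℝ := ∑ j ∈ Finset.univ.erase i, α j * (P (idx j)).toReal
    have hsum (t : ℝ) : ∑ j, α j * c t j = α i * t + rest := by
      rw [← Finset.add_sum_erase _ _ (Finset.mem_univ i)]
      congr 1
      · simp [c]
      · refine Finset.sum_congr rfl fun j hj => ?_
        simp [c, Function.update_of_ne (Finset.ne_of_mem_erase hj)]
    have hle := price_le (c ((r + 1 - rest) / α i)) fun j h₁ h₂ => by
      have hji : j ≠ i := by
        rintro rfl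
        exact hP.elim h₁ h₂
      simpa [c, Function.update_of_ne hji] using toReal_spec j h₁ h₂
    rw [hsum, mul_div_cancel₀ _ hi, sub_add_cancel] at hle
    exact lt_of_lt_of_le (by exact_mod_cast lt_add_one r) hle
  · push Not at hfin
    have hterm (j : Fin n) :
        (α j : EReal) * P (idx j) = (α j : EReal) * ((P (idx j)).toReal : EReal) := by
      by_cases hj : α j = 0
      · simp [hj]
      · rw [toReal_spec j (hfin j hj).1 (hfin j hj).2]
    simp only [hterm, EReal.sum_coe_mul_coe]
    exact price_le _ toReal_spec

theorem Coherent1.extCoherent {Ω I : Type*} [Nonempty Ω] {X : I → Ω → ℝ} {P : I → EReal}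
    (h : Coherent1 X (fun _ => (Set.univ : Set Ω)) P) : ExtCoherent X P := by
  have upper (n : ℕ) (idx : Fin n → I) (α : Fin n → ℝ) :
      ∑ j, (α j : EReal) * P (idx j) ≤ ⨆ ω, ((∑ j, α j * X (idx j) ω : ℝ) : EReal) := by
    by_cases hbot : ∃ j, (α j : EReal) * P (idx j) = ⊥
    · obtain ⟨j, hj⟩ := hbot
      rw [EReal.sum_eq_bot_of_mem (Finset.mem_univ j) hj]
      exact bot_le
    · exact h.sum_le_iSup idx α (not_exists.1 hbot)
  intro n idx α hα
  refine ⟨?_, upper n idx α⟩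
  have hneg : ∑ j, -((α j : EReal) * P (idx j)) = -∑ j, (α j : EReal) * P (idx j) :=
    hα.elim EReal.sum_neg_of_ne_top EReal.sum_neg_of_ne_bot
  have hup := upper n idx (fun j => -α j)
  simp only [EReal.coe_neg, hneg, neg_mul, Finset.sum_neg_distrib] at hup
  rw [← EReal.neg_iSup_neg]
  exact EReal.neg_le_of_neg_le hup

theorem ExtCoherent.coherent1 {Ω I : Type*} [Nonempty Ω] {X : I → Ω → ℝ} {P : I → EReal}
    (h : ExtCoherent X P) : Coherent1 X (fun _ => (Set.univ : Set Ω)) P := by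
  intro n idx α c htop hbot hc
  have hα (j : Fin n) : (α j : EReal) * P (idx j) ≠ ⊥ :=
    (EReal.coe_mul_ne_bot_iff _ _).2 ⟨htop j, hbot j⟩
  refine (zero_le_iSup_gamble_iff _ α c).2 (le_trans ?_ (h n idx α (.inr hα)).2)
  rw [← EReal.sum_coe_mul_coe]
  refine Finset.sum_le_sum fun j _ => ?_
  rcases eq_or_ne (α j) 0 with hj | hj
  · simp [hj]
  by_cases hPt : P (idx j) = ⊤
  · rw [hPt, EReal.coe_mul_top_of_pos ((htop j hPt).lt_of_ne' hj)]
    exact le_top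
  by_cases hPb : P (idx j) = ⊥
  · rw [hPb, EReal.coe_mul_bot_of_neg ((hbot j hPb).lt_of_ne hj)]
    exact le_top
  · rw [hc j hPt hPb]

/-- A collection of extended-real marginal previsions is extended-coherent if and
only if it is coherent₁. -/
theorem extCoherent_iff_coherent1 {Ω I : Type*} [Nonempty Ω]
    (X : I → Ω → ℝ) (P : I → EReal) :
    ExtCoherent X P ↔ Coherent1 X (fun _ => (Set.univ : Set Ω)) P := by
  exact ⟨ExtCoherent.coherent1, Coherent1.extCoherent⟩

end
end

section
/- Let B be a nonempty event and let X and Y be random variables such that the collection consisting of the marginal prevision P(B), with P(B) > 0, and the conditional previsions P(X|B) and P(Y|B) is coherent₁. If X(ω) ≤ Y(ω) for all ω ∈ B, then P(X|B) ≤ P(Y|B) (as extended reals). -/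
open scoped BigOperators

noncomputable section

/-- Real prices separating two extended reals `q < p`, agreeing with them where these are finite. -/
lemma exists_prices_of_lt {p q : EReal} (h : q < p) :
    ∃ a b : ℝ, b < a ∧ (p ≠ ⊤ → (a : EReal) = p) ∧ (q ≠ ⊥ → (b : EReal) = q) := by
  induction p with
  | bot => exact absurd h not_lt_bot
  | top =>
    induction q with
    | bot => exact ⟨1, 0, by simp, by simp, by simp⟩
    | top => exact absurd h (lt_irrefl _)
    | coe q => exact ⟨q + 1, q, by simp, by simp, by simp⟩
  | coe p =>
    induction q with
    | bot => exact ⟨p, p - 1, by simp, by simp, by simp⟩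
    | top => exact absurd h not_top_lt
    | coe q => exact ⟨p, q, EReal.coe_lt_coe_iff.mp h, by simp, by simp⟩

/-- If the marginal prevision `P(B) = pB > 0` together with the conditional previsions
`P(X|B) = pX` and `P(Y|B) = pY` form a coherent₁ collection, and `X ≤ Y` on `B`,
then `pX ≤ pY` as extended reals. -/
theorem le_prevision_of_le_on_event {Ω : Type*} [Nonempty Ω] (B : Set Ω) (hB : B.Nonempty)
    (X Y : Ω → ℝ) (pB pX pY : EReal) (hpB : 0 < pB)
    (hcoh : Coherent1 ![indicatorRV B, X, Y] ![Set.univ, B, B] ![pB, pX, pY])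
    (hle : ∀ ω ∈ B, X ω ≤ Y ω) :
    pX ≤ pY := by
  by_contra! hlt
  obtain ⟨a, b, hab, ha, hb⟩ := exists_prices_of_lt hlt
  obtain ⟨c, z, hzc, hc, hz⟩ := exists_prices_of_lt hpB
  have hz0 : z = 0 := by simpa using hz (by simp)
  subst hz0
  have hpX : pX ≠ ⊥ := ne_bot_of_gt hlt
  have hpY : pY ≠ ⊤ := ne_top_of_lt hlt
  have hpB' : pB ≠ ⊥ := ne_bot_of_gt hpB
  have hd : 0 < a - b := sub_pos.mpr hab
  have key := hcoh 3 id ![a - b, 1, -1] ![c, a, b]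
    (by simp [Fin.forall_fin_succ, hpY, hab.le])
    (by simp [Fin.forall_fin_succ, hpX, hpB'])
    (by simpa [Fin.forall_fin_succ] using ⟨fun h _ => hc h, fun h _ => ha h, fun _ h => hb h⟩)
  refine key.not_gt (lt_of_le_of_lt (iSup_le fun ω => EReal.coe_le_coe_iff.mpr ?_)
    (EReal.coe_neg'.mpr (neg_neg_of_pos (mul_pos hd hzc))))
  by_cases hω : ω ∈ B
  · have := hle ω hω
    simp [Fin.sum_univ_succ, indicatorRV, hω]
    linarith
  · simp [Fin.sum_univ_succ, indicatorRV, hω]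

end
end

section
/- Let 𝒞 be a nonempty class of scoring rules of Savage form. A collection {P(X_i|B_i): i ∈ I} of extended-real-valued conditional previsions is coherent₁ if and only if it is coherent₃ with respect to 𝒞. -/
open scoped BigOperators

noncomputable section

open MeasureTheory

/-- A strictly proper scoring rule of Savage form: `g x q = ∫ v in x..q, (v - x) ∂lam`,
where `lam` is a Borel measure on `ℝ` mutually absolutely continuous with Lebesgue
measure and finite on every bounded interval.  (The interval integral convention makes
an integral with limits in the wrong order equal to the negative of the integral with
the limits in the correct order.) -/
structure SavageRule where
  g : ℝ → ℝ → ℝ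
  lam : Measure ℝ
  absCont : lam ≪ volume
  absCont' : volume ≪ lam
  finiteOnBounded : ∀ a b : ℝ, lam (Set.Icc a b) < ⊤
  g_eq : ∀ x q : ℝ, g x q = ∫ v in x..q, (v - x) ∂lam

/-- Coherence₃ with respect to a class `C` of scoring rules: no finite rival set of
real forecasts `q j`, scored with rules from `C`, gives a uniformly smaller sum of
scores than the forecasts, where the score of a forecast `p (idx j)` is computed at a
real value `c j` equal to it when it is finite and lying between `q j` and
`p (idx j)` when it is infinite. -/
def Coherent3 {Ω I : Type*} (C : Set SavageRule) (X : I → Ω → ℝ) (B : I → Set Ω)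
    (P : I → EReal) : Prop :=
  ∀ (n : ℕ) (idx : Fin n → I) (G : Fin n → SavageRule),
    (∀ j, G j ∈ C) →
    ∀ q c : Fin n → ℝ,
      (∀ j, P (idx j) ≠ ⊤ → P (idx j) ≠ ⊥ → (c j : EReal) = P (idx j)) →
      (∀ j, P (idx j) = ⊤ → q j ≤ c j) →
      (∀ j, P (idx j) = ⊥ → c j ≤ q j) →
      (⨅ ω, ((∑ j, indicatorRV (B (idx j)) ω *
        ((G j).g (X (idx j) ω) (c j) - (G j).g (X (idx j) ω) (q j)) : ℝ) : EReal)) ≤ 0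

namespace SavageRule

variable (G : SavageRule)

instance : NullSingletonClass G.lam := ⟨fun x => G.absCont (measure_singleton x)⟩

instance : IsLocallyFiniteMeasure G.lam :=
  ⟨fun x => ⟨Set.Icc (x - 1) (x + 1), Icc_mem_nhds (by linarith) (by linarith),
    G.finiteOnBounded _ _⟩⟩

/-- The signed `G.lam`-mass of the oriented interval from `q` to `c`. -/
def mass (q c : ℝ) : ℝ := ∫ _ in q..c, (1 : ℝ) ∂G.lam

theorem intervalIntegrable_of_continuous {f : ℝ → ℝ} (hf : Continuous f) (a b : ℝ) :
    IntervalIntegrable f G.lam a b :=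
  hf.intervalIntegrable a b

theorem mass_symm (q c : ℝ) : G.mass q c = -G.mass c q :=
  intervalIntegral.integral_symm _ _

theorem mass_self (c : ℝ) : G.mass c c = 0 :=
  intervalIntegral.integral_same

theorem mass_nonneg {q c : ℝ} (h : q ≤ c) : 0 ≤ G.mass q c :=
  intervalIntegral.integral_nonneg h fun _ _ => zero_le_one

theorem mass_nonpos {q c : ℝ} (h : c ≤ q) : G.mass q c ≤ 0 := by
  rw [mass_symm]
  exact neg_nonpos.2 (G.mass_nonneg h)

theorem mass_pos {q c : ℝ} (h : q < c) : 0 < G.mass q c := by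
  have hne : G.lam (Set.Ioc q c) ≠ 0 := fun h0 => by
    have hv := G.absCont' h0
    rw [Real.volume_Ioc, ENNReal.ofReal_eq_zero] at hv
    linarith
  have htop : G.lam (Set.Ioc q c) ≠ ⊤ :=
    ((measure_mono Set.Ioc_subset_Icc_self).trans_lt (G.finiteOnBounded q c)).ne
  rw [mass, intervalIntegral.integral_of_le h.le, setIntegral_const, smul_eq_mul, mul_one]
  exact ENNReal.toReal_pos hne htop

theorem continuous_mass_left (c : ℝ) : Continuous fun q => G.mass q c := by
  have h : (fun q => G.mass q c) = fun q => -G.mass c q := funext fun q => G.mass_symm q c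
  rw [h]
  exact (intervalIntegral.continuous_primitive
    (fun a b => G.intervalIntegrable_of_continuous continuous_const a b) c).neg

theorem g_sub_g (x c q : ℝ) :
    G.g x c - G.g x q = (∫ v in q..c, (v - c) ∂G.lam) + G.mass q c * (c - x) := by
  have hint (f : ℝ → ℝ) (hf : Continuous f) (a b : ℝ) :=
    G.intervalIntegrable_of_continuous hf a b
  rw [G.g_eq, G.g_eq, intervalIntegral.integral_interval_sub_left
    (hint _ (by fun_prop) _ _) (hint _ (by fun_prop) _ _), mass,
    ← intervalIntegral.integral_mul_const, ← intervalIntegral.integral_add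
    (hint _ (by fun_prop) _ _) (hint _ (by fun_prop) _ _)]
  congr 1
  ext v
  ring

theorem integral_sub_right_nonpos (q c : ℝ) : ∫ v in q..c, (v - c) ∂G.lam ≤ 0 := by
  rcases le_total q c with h | h
  · have h0 : 0 ≤ ∫ v in q..c, -(v - c) ∂G.lam :=
      intervalIntegral.integral_nonneg h fun v hv => by linarith [hv.2]
    rw [intervalIntegral.integral_neg] at h0
    linarith
  · rw [intervalIntegral.integral_symm]
    exact neg_nonpos.2 (intervalIntegral.integral_nonneg h fun v hv => by linarith [hv.1])

theorem neg_mul_abs_mass_le_integral {q c δ : ℝ} (hδ : |q - c| ≤ δ) :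
    -(δ * |G.mass q c|) ≤ ∫ v in q..c, (v - c) ∂G.lam := by
  have hint (f : ℝ → ℝ) (hf : Continuous f) (a b : ℝ) :=
    G.intervalIntegrable_of_continuous hf a b
  obtain ⟨hl, hr⟩ := abs_le.1 hδ
  rcases le_total q c with h | h
  · rw [abs_of_nonneg (G.mass_nonneg h), mass, ← intervalIntegral.integral_const_mul,
      ← intervalIntegral.integral_neg]
    exact intervalIntegral.integral_mono_on h (hint _ (by fun_prop) _ _)
      (hint _ (by fun_prop) _ _) fun v hv => by linarith [hv.1]
  · rw [abs_of_nonpos (G.mass_nonpos h), ← mass_symm, mass,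
      ← intervalIntegral.integral_const_mul, intervalIntegral.integral_symm c q]
    exact neg_le_neg (intervalIntegral.integral_mono_on h (hint _ (by fun_prop) _ _)
      (hint _ (by fun_prop) _ _) fun v hv => by linarith [hv.2])

/-- Every signed mass that is small enough is attained by an interval ending at `c` whose
other endpoint is within `δ` of `c`. -/
theorem exists_mass_eq (c : ℝ) {δ : ℝ} (hδ : 0 < δ) :
    ∃ r > 0, ∀ s, |s| ≤ r →
      ∃ q, |q - c| ≤ δ ∧ (0 ≤ s → q ≤ c) ∧ (s ≤ 0 → c ≤ q) ∧ G.mass q c = s := by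
  have hneg : 0 < -G.mass (c + δ) c := by
    rw [← mass_symm]
    exact G.mass_pos (by linarith)
  refine ⟨min (G.mass (c - δ) c) (-G.mass (c + δ) c),
    lt_min (G.mass_pos (by linarith)) hneg, fun s hs => ?_⟩
  obtain ⟨h₁, h₂⟩ := le_min_iff.1 hs
  rcases lt_trichotomy s 0 with h0 | rfl | h0
  · obtain ⟨q, hq, rfl⟩ := intermediate_value_Icc' (show c ≤ c + δ by linarith)
      (G.continuous_mass_left c).continuousOn
      (show s ∈ Set.Icc (G.mass (c + δ) c) (G.mass c c) from
        ⟨by linarith [neg_abs_le s], by rw [mass_self]; exact h0.le⟩)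
    exact ⟨q, abs_le.2 ⟨by linarith [hq.1], by linarith [hq.2]⟩,
      fun h => absurd h0 h.not_gt, fun _ => hq.1, rfl⟩
  · exact ⟨c, by simpa using hδ.le, fun _ => le_rfl, fun _ => le_rfl, G.mass_self c⟩
  · obtain ⟨q, hq, rfl⟩ := intermediate_value_Icc' (show c - δ ≤ c by linarith)
      (G.continuous_mass_left c).continuousOn
      (show s ∈ Set.Icc (G.mass c c) (G.mass (c - δ) c) from
        ⟨by rw [mass_self]; exact h0.le, by linarith [le_abs_self s]⟩)
    exact ⟨q, abs_le.2 ⟨by linarith [hq.1], by linarith [hq.2]⟩,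
      fun _ => hq.2, fun h => absurd h0 h.not_gt, rfl⟩

end SavageRule

theorem indicatorRV_nonneg {Ω : Type*} (B : Set Ω) (ω : Ω) : 0 ≤ indicatorRV B ω :=
  Set.indicator_nonneg (fun _ _ => zero_le_one) ω

theorem indicatorRV_le_one {Ω : Type*} (B : Set Ω) (ω : Ω) : indicatorRV B ω ≤ 1 :=
  Set.indicator_le' (fun _ _ => le_rfl) (fun _ _ => zero_le_one) ω

theorem exists_forall_le_of_iSup_coe_lt_zero {Ω : Type*} {f : Ω → ℝ}
    (h : ⨆ ω, (f ω : EReal) < 0) : ∃ ε > 0, ∀ ω, f ω ≤ -ε := by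
  obtain ⟨r, hr, hr0⟩ := EReal.lt_iff_exists_real_btwn.1 h
  refine ⟨-r, neg_pos.2 (by exact_mod_cast hr0), fun ω => ?_⟩
  rw [neg_neg]
  exact_mod_cast (le_iSup (fun ω => (f ω : EReal)) ω).trans hr.le

theorem exists_forall_le_of_zero_lt_iInf_coe {Ω : Type*} {f : Ω → ℝ}
    (h : 0 < ⨅ ω, (f ω : EReal)) : ∃ ε > 0, ∀ ω, ε ≤ f ω := by
  obtain ⟨r, hr0, hr⟩ := EReal.lt_iff_exists_real_btwn.1 h
  exact ⟨r, by exact_mod_cast hr0, fun ω => by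
    exact_mod_cast hr.le.trans (iInf_le (fun ω => (f ω : EReal)) ω)⟩

theorem Coherent1.coherent3 {Ω I : Type*} {C : Set SavageRule} {X : I → Ω → ℝ}
    {B : I → Set Ω} {P : I → EReal} (h : Coherent1 X B P) : Coherent3 C X B P := by
  intro n idx G _ q c hc htop hbot
  by_contra! hlt
  obtain ⟨ε, hε, hle⟩ := exists_forall_le_of_zero_lt_iInf_coe hlt
  have hsup := h n idx (fun j => (G j).mass (q j) (c j)) c
    (fun j hj => (G j).mass_nonneg (htop j hj)) (fun j hj => (G j).mass_nonpos (hbot j hj)) hc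
  refine absurd (hsup.trans (iSup_le (a := ((-ε : ℝ) : EReal)) fun ω => ?_)) ?_
  · rw [EReal.coe_le_coe_iff, le_neg]
    refine (hle ω).trans ?_
    rw [← Finset.sum_neg_distrib]
    refine Finset.sum_le_sum fun j _ => ?_
    rw [SavageRule.g_sub_g]
    linarith [mul_nonpos_of_nonneg_of_nonpos (indicatorRV_nonneg (B (idx j)) ω)
      ((G j).integral_sub_right_nonpos (q j) (c j))]
  · rw [not_le]
    exact_mod_cast neg_neg_of_pos hε

theorem Coherent3.coherent1 {Ω I : Type*} {C : Set SavageRule} (hC : C.Nonempty)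
    {X : I → Ω → ℝ} {B : I → Set Ω} {P : I → EReal} (h : Coherent3 C X B P) :
    Coherent1 X B P := by
  obtain ⟨G, hG⟩ := hC
  intro n idx α c htop hbot hc
  by_contra! hlt
  obtain ⟨ε, hε, hle⟩ := exists_forall_le_of_iSup_coe_lt_zero hlt
  obtain ⟨δ, hδ, hδε⟩ : ∃ δ > 0, δ * ∑ j, |α j| < ε := by
    have hS : 0 ≤ ∑ j, |α j| := Finset.sum_nonneg fun j _ => abs_nonneg _
    refine ⟨ε / (∑ j, |α j| + 1), by positivity, ?_⟩
    rw [div_mul_eq_mul_div, div_lt_iff₀ (by positivity)]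
    linarith
  choose r hr hq using fun j => G.exists_mass_eq (c j) hδ
  obtain ⟨t, ht, htr⟩ : ∃ t > 0, ∀ j, |t * α j| ≤ r j := by
    have hev : ∀ᶠ t in nhdsWithin (0 : ℝ) (Set.Ioi 0), ∀ j, |t * α j| ≤ r j := by
      refine Filter.eventually_all.2 fun j => nhdsWithin_le_nhds ?_
      have hcont : ContinuousAt (fun t : ℝ => |t * α j|) 0 := by fun_prop
      exact (hcont.eventually_lt continuousAt_const (by simpa using hr j)).mono
        fun _ => le_of_lt
    obtain ⟨t, htr, ht⟩ := (hev.and self_mem_nhdsWithin).exists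
    exact ⟨t, ht, htr⟩
  choose q hqδ hqpos hqneg hqmass using fun j => hq j _ (htr j)
  have hinf := h n idx (fun _ => G) (fun _ => hG) q c hc
    (fun j hj => hqpos j (mul_nonneg ht.le (htop j hj)))
    (fun j hj => hqneg j (mul_nonpos_of_nonneg_of_nonpos ht.le (hbot j hj)))
  refine absurd ((le_iInf (a := ((t * (ε - δ * ∑ j, |α j|) : ℝ) : EReal))
    fun ω => ?_).trans hinf) ?_
  · rw [EReal.coe_le_coe_iff]
    calc t * (ε - δ * ∑ j, |α j|)
        ≤ t * (-(∑ j, α j * indicatorRV (B (idx j)) ω * (X (idx j) ω - c j))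
            - δ * ∑ j, |α j|) := by
          have := hle ω
          gcongr
          linarith
      _ = ∑ j, (-(δ * (t * |α j|))
            + indicatorRV (B (idx j)) ω * (t * α j * (c j - X (idx j) ω))) := by
          rw [Finset.mul_sum, ← Finset.sum_neg_distrib, ← Finset.sum_sub_distrib,
            Finset.mul_sum]
          exact Finset.sum_congr rfl fun j _ => by ring
      _ ≤ _ := by
          refine Finset.sum_le_sum fun j _ => ?_
          have hlow := G.neg_mul_abs_mass_le_integral (hqδ j)
          have hnonpos := G.integral_sub_right_nonpos (q j) (c j)
          rw [hqmass, abs_mul, abs_of_pos ht] at hlow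
          rw [SavageRule.g_sub_g, hqmass, mul_add]
          gcongr
          nlinarith [indicatorRV_le_one (B (idx j)) ω]
  · rw [not_le]
    exact_mod_cast mul_pos ht (sub_pos.2 hδε)

/-- For any nonempty class `C` of scoring rules of Savage form, a collection of
extended-real conditional previsions is coherent₁ if and only if it is coherent₃
with respect to `C`. -/
theorem coherent1_iff_coherent3 {Ω I : Type*} [Nonempty Ω]
    (C : Set SavageRule) (hC : C.Nonempty)
    (X : I → Ω → ℝ) (B : I → Set Ω) (hBne : ∀ i, (B i).Nonempty) (P : I → EReal) :
    Coherent1 X B P ↔ Coherent3 C X B P := by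
  exact ⟨Coherent1.coherent3, Coherent3.coherent1 hC⟩

end
end

section
/- Let L be a finitely additive expectation on a linear space 𝓛 of real-valued functions on Ω. Then the collection of marginal previsions {P(X) = L(X) : X ∈ 𝓛} is coherent₁. -/
open scoped BigOperators

noncomputable section

/-- A finitely additive Daniell integral: an extended-real-valued functional `L` on a
linear space `dom` of real-valued functions on `Ω` containing all constant functions,
which is nonnegative (monotone) and extended-linear whenever the right-hand side of the
linearity equation is well defined (not `∞ - ∞`; note that in `EReal` one has
`(0 : EReal) * ⊤ = 0` and `(0 : EReal) * ⊥ = 0`). -/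
structure FADaniell (Ω : Type*) where
  dom : Set (Ω → ℝ)
  const_mem : ∀ c : ℝ, (fun _ => c) ∈ dom
  add_mem : ∀ X ∈ dom, ∀ Y ∈ dom, (fun ω => X ω + Y ω) ∈ dom
  smul_mem : ∀ (a : ℝ), ∀ X ∈ dom, (fun ω => a * X ω) ∈ dom
  L : (Ω → ℝ) → EReal
  mono : ∀ X ∈ dom, ∀ Y ∈ dom, (∀ ω, X ω ≤ Y ω) → L X ≤ L Y
  extLinear : ∀ (a b : ℝ), ∀ X ∈ dom, ∀ Y ∈ dom,
    ¬(((a : EReal) * L X = ⊤ ∧ (b : EReal) * L Y = ⊥) ∨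
      ((a : EReal) * L X = ⊥ ∧ (b : EReal) * L Y = ⊤)) →
    L (fun ω => a * X ω + b * Y ω) = (a : EReal) * L X + (b : EReal) * L Y

namespace FADaniell

variable {Ω : Type*} (D : FADaniell Ω)

lemma L_const (hnorm : D.L (fun _ => 1) = 1) (r : ℝ) : D.L (fun _ => r) = r := by
  have h := D.extLinear r 0 _ (D.const_mem 1) _ (D.const_mem 1) (by simp [hnorm])
  simpa [hnorm] using h

lemma L_add_nonneg {X Y : Ω → ℝ} (hX : X ∈ D.dom) (hY : Y ∈ D.dom)
    (hLX : 0 ≤ D.L X) (hLY : 0 ≤ D.L Y) : 0 ≤ D.L (fun ω => X ω + Y ω) := by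
  have h := D.extLinear 1 1 X hX Y hY (by
    simp only [EReal.coe_one, one_mul]
    rintro (⟨-, h⟩ | ⟨h, -⟩)
    · simp [h] at hLY
    · simp [h] at hLX)
  simp only [EReal.coe_one, one_mul] at h
  rw [h]
  exact add_nonneg hLX hLY

lemma sum_mem_and_L_nonneg (hnorm : D.L (fun _ => 1) = 1) {ι : Type*} (s : Finset ι)
    {X : ι → Ω → ℝ} (hX : ∀ i, X i ∈ D.dom) (hL : ∀ i, 0 ≤ D.L (X i)) :
    (fun ω => ∑ i ∈ s, X i ω) ∈ D.dom ∧ 0 ≤ D.L (fun ω => ∑ i ∈ s, X i ω) := by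
  classical
  induction s using Finset.induction_on with
  | empty => simpa [D.L_const hnorm] using D.const_mem 0
  | insert i s hi ih =>
    simp only [Finset.sum_insert hi]
    exact ⟨D.add_mem _ (hX i) _ ih.1, D.L_add_nonneg (hX i) ih.1 (hL i) ih.2⟩

lemma mul_sub_mem {X : Ω → ℝ} (hX : X ∈ D.dom) (a c : ℝ) :
    (fun ω => a * (X ω - c)) ∈ D.dom := by
  simpa only [sub_eq_add_neg] using
    D.smul_mem a _ (D.add_mem X hX _ (D.const_mem (-c)))

lemma L_mul_sub (hnorm : D.L (fun _ => 1) = 1) {X : Ω → ℝ} (hX : X ∈ D.dom) (a c : ℝ) :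
    D.L (fun ω => a * (X ω - c)) = a * D.L X + (-(a * c) : ℝ) := by
  have h := D.extLinear a (-(a * c)) X hX _ (D.const_mem 1) (by
    rw [hnorm, mul_one]
    exact not_or.2 ⟨fun h => EReal.coe_ne_bot _ h.2, fun h => EReal.coe_ne_top _ h.2⟩)
  simp only [hnorm, mul_one] at h
  rw [← h]
  congr 1
  funext ω
  ring

lemma L_mul_sub_nonneg (hnorm : D.L (fun _ => 1) = 1) {X : Ω → ℝ} (hX : X ∈ D.dom)
    {a c : ℝ} (htop : D.L X = ⊤ → 0 ≤ a) (hbot : D.L X = ⊥ → a ≤ 0)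
    (hc : D.L X ≠ ⊤ → D.L X ≠ ⊥ → (c : EReal) = D.L X) :
    0 ≤ D.L (fun ω => a * (X ω - c)) := by
  rw [D.L_mul_sub hnorm hX]
  rcases eq_or_ne a 0 with rfl | ha
  · simp
  by_cases ht : D.L X = ⊤
  · rw [ht, EReal.coe_mul_top_of_pos ((htop ht).lt_of_ne' ha), EReal.top_add_coe]
    exact le_top
  by_cases hb : D.L X = ⊥
  · rw [hb, EReal.coe_mul_bot_of_neg ((hbot hb).lt_of_ne ha), EReal.top_add_coe]
    exact le_top
  rw [← hc ht hb, ← EReal.coe_mul, ← EReal.coe_add, add_neg_cancel, EReal.coe_zero]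

/-- The supremum of a function with nonnegative expectation is nonnegative. -/
lemma iSup_nonneg_of_L_nonneg (hnorm : D.L (fun _ => 1) = 1) {X : Ω → ℝ} (hX : X ∈ D.dom)
    (hL : 0 ≤ D.L X) : 0 ≤ ⨆ ω, (X ω : EReal) := by
  by_contra! h
  obtain ⟨r, hr, hr0⟩ := EReal.lt_iff_exists_real_btwn.1 h
  have hle : D.L X ≤ r := by
    rw [← D.L_const hnorm r]
    exact D.mono X hX _ (D.const_mem r) fun ω =>
      EReal.coe_le_coe_iff.1 ((le_iSup (fun ω => (X ω : EReal)) ω).trans hr.le)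
  exact (hL.trans hle).not_gt hr0

end FADaniell

/-- A finitely additive expectation (a finitely additive Daniell integral with
`L 1 = 1`) on a linear space, used as a collection of marginal previsions, is
coherent₁. -/
theorem fae_coherent1 {Ω : Type*} [Nonempty Ω] (D : FADaniell Ω)
    (hnorm : D.L (fun _ => 1) = 1) :
    Coherent1 (fun f : D.dom => (f : Ω → ℝ)) (fun _ => (Set.univ : Set Ω))
      (fun f => D.L f) := by
  intro n idx α c htop hbot hc
  simp only [indicatorRV, Set.indicator_univ, mul_one]
  obtain ⟨hmem, hL⟩ := D.sum_mem_and_L_nonneg hnorm Finset.univ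
    (fun j => D.mul_sub_mem (idx j).2 (α j) (c j))
    (fun j => D.L_mul_sub_nonneg hnorm (idx j).2 (htop j) (hbot j) (hc j))
  exact D.iSup_nonneg_of_L_nonneg hnorm hmem hL

end
end

section
/- Let 𝒟 = {X_i: i ∈ I} be a set of random variables containing all constant functions, and let Q be a coherent₁ collection of marginal previsions on 𝒟. Let 𝓛 be the set of random variables Y admitting a representation Y = Σ_{j=1}^n α_j X_{i_j} with each X_{i_j} ∈ 𝒟 and with p_Y = Σ_{j=1}^n α_j Q(X_{i_j}) a well-defined extended-real sum (not ∞ − ∞). Then: (i) the value p_Y is the same for every such representation of Y, so P(Y) = p_Y is well defined on 𝓛; (ii) P is a coherent₁ collection of marginal previsions on 𝓛 extending Q; and (iii) for each Y ∈ 𝓛, any assignment P(Y) = p with p ≠ p_Y is incoherent₁ in combination with Q, so P is the unique coherent₁ extension of Q to 𝓛. -/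
open scoped BigOperators

noncomputable section

/-- Adjoin one further random variable to a collection indexed by `I`
(the new one is indexed by `none`). -/
def adjoinX {Ω I : Type*} (X : I → Ω → ℝ) (Y : Ω → ℝ) : Option I → Ω → ℝ :=
  fun o => o.elim Y X

/-- Adjoin one further conditioning event to a collection indexed by `I`. -/
def adjoinB {Ω I : Type*} (B : I → Set Ω) (C : Set Ω) : Option I → Set Ω :=
  fun o => o.elim C B

/-- Adjoin one further prevision to a collection indexed by `I`. -/
def adjoinP {I : Type*} (P : I → EReal) (p : EReal) : Option I → EReal :=
  fun o => o.elim p P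

/-- The part of the linear span of `D` on which the induced prevision is well defined:
functions `Y = ∑ j, α j • F j` with each `F j ∈ D` such that the extended-real sum
`∑ j, α j * Q (F j)` has no two infinite terms of opposite signs. -/
def wellDefSpan {Ω : Type*} (D : Set (Ω → ℝ)) (Q : (Ω → ℝ) → EReal) : Set (Ω → ℝ) :=
  {Y | ∃ (n : ℕ) (F : Fin n → Ω → ℝ) (α : Fin n → ℝ),
    (∀ j, F j ∈ D) ∧ (∀ ω, Y ω = ∑ j, α j * F j ω) ∧
    ((∀ j, (α j : EReal) * Q (F j) ≠ ⊤) ∨ (∀ j, (α j : EReal) * Q (F j) ≠ ⊥))}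

namespace EReal

theorem coe_finsetSum {ι : Type*} (s : Finset ι) (f : ι → ℝ) :
    ((∑ j ∈ s, f j : ℝ) : EReal) = ∑ j ∈ s, (f j : EReal) :=
  map_sum (⟨⟨Real.toEReal, coe_zero⟩, coe_add⟩ : ℝ →+ EReal) f s

theorem sum_eq_bot_of_mem_s7 {ι : Type*} {s : Finset ι} {f : ι → EReal} {i : ι} (hi : i ∈ s)
    (h : f i = ⊥) : ∑ j ∈ s, f j = ⊥ := by
  classical
  rw [← Finset.add_sum_erase s f hi, h, bot_add]

theorem sum_ne_bot_s7 {ι : Type*} {s : Finset ι} {f : ι → EReal} (h : ∀ i ∈ s, f i ≠ ⊥) :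
    ∑ j ∈ s, f j ≠ ⊥ :=
  Finset.sum_induction f (· ≠ ⊥) (fun _ _ ha hb => by simp [add_eq_bot_iff, ha, hb])
    zero_ne_bot h

theorem sum_eq_top_of_mem {ι : Type*} {s : Finset ι} {f : ι → EReal} {i : ι} (hi : i ∈ s)
    (h : f i = ⊤) (hbot : ∀ j ∈ s, f j ≠ ⊥) : ∑ j ∈ s, f j = ⊤ := by
  classical
  rw [← Finset.add_sum_erase s f hi, h, top_add_of_ne_bot]
  exact sum_ne_bot_s7 fun j hj => hbot j (Finset.mem_of_mem_erase hj)

end EReal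

/-- Real prices, equal to the previsions where these are finite, can be chosen so that a
linear combination of them attains any price admissible for the combined prevision. -/
theorem exists_prices {ι : Type*} [Fintype ι] (α : ι → ℝ) (q : ι → EReal) (c : ℝ)
    (hc : ∑ j, (α j : EReal) * q j ≠ ⊤ → ∑ j, (α j : EReal) * q j ≠ ⊥ →
      (c : EReal) = ∑ j, (α j : EReal) * q j) :
    ∃ d : ι → ℝ, (∀ j, q j ≠ ⊤ → q j ≠ ⊥ → (d j : EReal) = q j) ∧ ∑ j, α j * d j = c := by
  classical
  by_cases h : ∃ j, α j ≠ 0 ∧ (q j = ⊤ ∨ q j = ⊥)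
  · obtain ⟨j, hj, hq⟩ := h
    refine ⟨Function.update (fun i => (q i).toReal) j
      ((c - ∑ i ∈ Finset.univ.erase j, α i * (q i).toReal) / α j), fun i ht hb => ?_, ?_⟩
    · have hij : i ≠ j := by
        rintro rfl
        exact hq.elim ht hb
      rw [Function.update_of_ne hij, EReal.coe_toReal ht hb]
    · rw [← Finset.add_sum_erase _ _ (Finset.mem_univ j), Function.update_self,
        mul_div_cancel₀ _ hj, sub_add_eq_add_sub, sub_eq_iff_eq_add, add_right_inj]
      refine Finset.sum_congr rfl fun i hi => ?_
      rw [Function.update_of_ne (Finset.ne_of_mem_erase hi)]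
  · push Not at h
    have hsum : ∑ j, (α j : EReal) * q j = ((∑ j, α j * (q j).toReal : ℝ) : EReal) := by
      rw [EReal.coe_finsetSum]
      refine Finset.sum_congr rfl fun j _ => ?_
      by_cases hj : α j = 0
      · simp [hj]
      · rw [EReal.coe_mul, EReal.coe_toReal (h j hj).1 (h j hj).2]
    refine ⟨fun j => (q j).toReal, fun j ht hb => EReal.coe_toReal ht hb, ?_⟩
    rw [hsum] at hc
    exact_mod_cast (hc (EReal.coe_ne_top _) (EReal.coe_ne_bot _)).symm

/-- `Y` is a finite linear combination of the `X i` whose prevision induced by `P` is a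
well-defined extended-real sum equal to `v`. -/
def Represents {Ω I : Type*} (X : I → Ω → ℝ) (P : I → EReal) (Y : Ω → ℝ) (v : EReal) : Prop :=
  ∃ (n : ℕ) (idx : Fin n → I) (α : Fin n → ℝ),
    (∀ ω, Y ω = ∑ j, α j * X (idx j) ω) ∧
    ((∀ j, (α j : EReal) * P (idx j) ≠ ⊤) ∨ (∀ j, (α j : EReal) * P (idx j) ≠ ⊥)) ∧
    v = ∑ j, (α j : EReal) * P (idx j)

theorem represents_self {Ω I : Type*} (X : I → Ω → ℝ) (P : I → EReal) (i : I) :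
    Represents X P (X i) (P i) := by
  refine ⟨1, fun _ => i, fun _ => 1, by simp, ?_, by simp⟩
  by_cases h : P i = ⊤ <;> simp [h]

/-- A coherent₁ collection of marginal previsions avoids sure loss for families of gambles
indexed by any finite type. -/
theorem Coherent1.iSup_nonneg {Ω I ι : Type*} [Fintype ι] {X : I → Ω → ℝ} {P : I → EReal}
    (h : Coherent1 X (fun _ => Set.univ) P) (idx : ι → I) (α c : ι → ℝ)
    (htop : ∀ j, P (idx j) = ⊤ → 0 ≤ α j) (hbot : ∀ j, P (idx j) = ⊥ → α j ≤ 0)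
    (hc : ∀ j, P (idx j) ≠ ⊤ → P (idx j) ≠ ⊥ → (c j : EReal) = P (idx j)) :
    0 ≤ ⨆ ω, ((∑ j, α j * (X (idx j) ω - c j) : ℝ) : EReal) := by
  let e := (Fintype.equivFin ι).symm
  have key := h _ (idx ∘ e) (α ∘ e) (c ∘ e) (fun j => htop (e j)) (fun j => hbot (e j))
    (fun j => hc (e j))
  refine key.trans_eq (iSup_congr fun ω => ?_)
  rw [← e.sum_comp]
  simp [indicatorRV]

theorem Coherent1.iSup_represents_nonneg {Ω I κ : Type*} [Fintype κ] {X : I → Ω → ℝ}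
    {P : I → EReal} (h : Coherent1 X (fun _ => Set.univ) P) (Y : κ → Ω → ℝ) (v : κ → EReal)
    (hY : ∀ k, Represents X P (Y k) (v k)) (γ c : κ → ℝ)
    (htop : ∀ k, v k = ⊤ → 0 ≤ γ k) (hbot : ∀ k, v k = ⊥ → γ k ≤ 0)
    (hc : ∀ k, v k ≠ ⊤ → v k ≠ ⊥ → (c k : EReal) = v k) :
    0 ≤ ⨆ ω, ((∑ k, γ k * (Y k ω - c k) : ℝ) : EReal) := by
  choose n idx α hrep hwell hv using hY
  have hprice k := exists_prices (α k) (fun j => P (idx k j)) (c k) (by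
    rw [← hv k]
    exact hc k)
  choose d hd hsum using hprice
  have term_top (k) (j) (hj : (α k j : EReal) * P (idx k j) = ⊤) : 0 ≤ γ k := by
    refine htop k ((hv k).trans (EReal.sum_eq_top_of_mem (Finset.mem_univ j) hj ?_))
    exact fun i _ => (hwell k).resolve_left (fun H => H j hj) i
  have term_bot (k) (j) (hj : (α k j : EReal) * P (idx k j) = ⊥) : γ k ≤ 0 :=
    hbot k ((hv k).trans (EReal.sum_eq_bot_of_mem_s7 (Finset.mem_univ j) hj))
  have key := h.iSup_nonneg (ι := Σ k, Fin (n k)) (fun p => idx p.1 p.2)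
    (fun p => γ p.1 * α p.1 p.2) (fun p => d p.1 p.2) ?_ ?_ (fun p => hd p.1 p.2)
  · refine key.trans_eq (iSup_congr fun ω => ?_)
    rw [Fintype.sum_sigma]
    congr 1
    refine Finset.sum_congr rfl fun k _ => ?_
    rw [hrep k, ← hsum k, ← Finset.sum_sub_distrib, Finset.mul_sum]
    exact Finset.sum_congr rfl fun j _ => by ring
  · rintro ⟨k, j⟩ hP
    rcases lt_trichotomy (α k j) 0 with hα | hα | hα
    · exact mul_nonneg_of_nonpos_of_nonpos
        (term_bot k j (by rw [hP, EReal.coe_mul_top_of_neg hα])) hα.le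
    · simp [hα]
    · exact mul_nonneg (term_top k j (by rw [hP, EReal.coe_mul_top_of_pos hα])) hα.le
  · rintro ⟨k, j⟩ hP
    rcases lt_trichotomy (α k j) 0 with hα | hα | hα
    · exact mul_nonpos_of_nonneg_of_nonpos
        (term_top k j (by rw [hP, EReal.coe_mul_bot_of_neg hα])) hα.le
    · simp [hα]
    · exact mul_nonpos_of_nonpos_of_nonneg
        (term_bot k j (by rw [hP, EReal.coe_mul_bot_of_pos hα])) hα.le

/-- Two extended reals `v < w` admit separated real prices. -/
theorem EReal.exists_prices_lt {v w : EReal} (h : v < w) :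
    ∃ s t : ℝ, s < t ∧ (v ≠ ⊤ → v ≠ ⊥ → (s : EReal) = v) ∧
      (w ≠ ⊤ → w ≠ ⊥ → (t : EReal) = w) := by
  induction v with
  | top => exact absurd h not_top_lt
  | bot =>
    refine ⟨w.toReal - 1, w.toReal, by simp, by simp, EReal.coe_toReal⟩
  | coe a =>
    induction w with
    | top => exact ⟨a, a + 1, by simp, by simp, by simp⟩
    | bot => exact absurd h not_lt_bot
    | coe b => exact ⟨a, b, by exact_mod_cast h, by simp, by simp⟩

theorem Coherent1.represents_not_lt {Ω I : Type*} [Nonempty Ω] {X : I → Ω → ℝ} {P : I → EReal}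
    (h : Coherent1 X (fun _ => Set.univ) P) {Y : Ω → ℝ} {v w : EReal}
    (hv : Represents X P Y v) (hw : Represents X P Y w) : ¬ v < w := by
  intro hlt
  obtain ⟨s, t, hst, hs, ht⟩ := EReal.exists_prices_lt hlt
  have key := h.iSup_represents_nonneg (fun _ : Fin 2 => Y) ![v, w]
    (Fin.forall_fin_two.2 ⟨hv, hw⟩) ![-1, 1] ![s, t]
    (Fin.forall_fin_two.2 ⟨fun H => absurd H hlt.ne_top, fun _ => by simp⟩)
    (Fin.forall_fin_two.2 ⟨fun _ => by simp, fun H => absurd H hlt.ne_bot⟩)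
    (Fin.forall_fin_two.2 ⟨hs, ht⟩)
  have hconst (ω : Ω) : ∑ k : Fin 2, (![-1, 1] : Fin 2 → ℝ) k * (Y ω - (![s, t] : Fin 2 → ℝ) k) =
      s - t := by
    simp [Fin.sum_univ_two]
  simp_rw [hconst, iSup_const] at key
  have : 0 ≤ s - t := by exact_mod_cast key
  linarith

theorem Coherent1.represents_unique {Ω I : Type*} [Nonempty Ω] {X : I → Ω → ℝ} {P : I → EReal}
    (h : Coherent1 X (fun _ => Set.univ) P) {Y : Ω → ℝ} {v w : EReal}
    (hv : Represents X P Y v) (hw : Represents X P Y w) : v = w :=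
  le_antisymm (not_lt.1 (h.represents_not_lt hw hv)) (not_lt.1 (h.represents_not_lt hv hw))

/-- Extension of a coherent₁ marginal prevision `Q` on a set `D` of random variables
containing all constants to the part `wellDefSpan D Q` of the linear span of `D` where
the induced prevision is well defined:  (i) the value `∑ j, α j * Q (F j)` does not
depend on the chosen representation, so `P Y = p_Y` is well defined; (ii) there is a
function `P` assigning to each member of the span the common value of its
representations, it extends `Q`, and it is coherent₁ on `wellDefSpan D Q`; (iii) for
any `Y` in the span, assigning any prevision `p ≠ p_Y` is incoherent₁ in combination
with `Q`, so `P` is the unique coherent₁ extension. -/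
theorem unique_coherent_extension_to_span {Ω : Type*} [Nonempty Ω]
    (D : Set (Ω → ℝ)) (hconst : ∀ c : ℝ, (fun _ => c) ∈ D)
    (Q : (Ω → ℝ) → EReal)
    (hQ : Coherent1 (fun f : D => (f : Ω → ℝ)) (fun _ => (Set.univ : Set Ω))
      (fun f => Q f)) :
    -- (i) the prevision induced on the span is well defined
    (∀ (n m : ℕ) (F : Fin n → Ω → ℝ) (G : Fin m → Ω → ℝ) (α : Fin n → ℝ)
        (β : Fin m → ℝ),
      (∀ j, F j ∈ D) → (∀ k, G k ∈ D) →
      (∀ ω, ∑ j, α j * F j ω = ∑ k, β k * G k ω) →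
      ((∀ j, (α j : EReal) * Q (F j) ≠ ⊤) ∨ (∀ j, (α j : EReal) * Q (F j) ≠ ⊥)) →
      ((∀ k, (β k : EReal) * Q (G k) ≠ ⊤) ∨ (∀ k, (β k : EReal) * Q (G k) ≠ ⊥)) →
      ∑ j, (α j : EReal) * Q (F j) = ∑ k, (β k : EReal) * Q (G k)) ∧
    -- (ii) it yields a coherent₁ extension of Q to the span
    (∃ P : (Ω → ℝ) → EReal,
      (∀ f ∈ D, P f = Q f) ∧
      (∀ (Y : Ω → ℝ) (n : ℕ) (F : Fin n → Ω → ℝ) (α : Fin n → ℝ),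
        (∀ j, F j ∈ D) → (∀ ω, Y ω = ∑ j, α j * F j ω) →
        ((∀ j, (α j : EReal) * Q (F j) ≠ ⊤) ∨ (∀ j, (α j : EReal) * Q (F j) ≠ ⊥)) →
        P Y = ∑ j, (α j : EReal) * Q (F j)) ∧
      Coherent1 (fun Y : wellDefSpan D Q => (Y : Ω → ℝ)) (fun _ => (Set.univ : Set Ω))
        (fun Y => P Y)) ∧
    -- (iii) the extension is unique: any other value is incoherent₁
    (∀ (Y : Ω → ℝ) (n : ℕ) (F : Fin n → Ω → ℝ) (α : Fin n → ℝ),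
      (∀ j, F j ∈ D) → (∀ ω, Y ω = ∑ j, α j * F j ω) →
      ((∀ j, (α j : EReal) * Q (F j) ≠ ⊤) ∨ (∀ j, (α j : EReal) * Q (F j) ≠ ⊥)) →
      ∀ p : EReal, p ≠ ∑ j, (α j : EReal) * Q (F j) →
        ¬ Coherent1 (adjoinX (fun f : D => (f : Ω → ℝ)) Y)
            (adjoinB (fun _ : D => (Set.univ : Set Ω)) Set.univ)
            (adjoinP (fun f : D => Q f) p)) := by
  have rep (Y : Ω → ℝ) (n : ℕ) (F : Fin n → Ω → ℝ) (α : Fin n → ℝ) (hF : ∀ j, F j ∈ D)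
      (hY : ∀ ω, Y ω = ∑ j, α j * F j ω)
      (hwell : (∀ j, (α j : EReal) * Q (F j) ≠ ⊤) ∨ (∀ j, (α j : EReal) * Q (F j) ≠ ⊥)) :
      Represents (fun f : D => (f : Ω → ℝ)) (fun f => Q f) Y (∑ j, (α j : EReal) * Q (F j)) :=
    ⟨n, fun j => ⟨F j, hF j⟩, α, hY, hwell, rfl⟩
  refine ⟨fun n m F G α β hF hG hFG hα hβ => ?_, ?_, ?_⟩
  · exact hQ.represents_unique (rep _ n F α hF (fun _ => rfl) hα) (rep _ m G β hG hFG hβ)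
  · classical
    let P (Y : Ω → ℝ) : EReal :=
      if h : ∃ v, Represents (fun f : D => (f : Ω → ℝ)) (fun f => Q f) Y v then h.choose else 0
    have hP {Y v} (h : Represents (fun f : D => (f : Ω → ℝ)) (fun f => Q f) Y v) : P Y = v := by
      have hex : ∃ v, Represents (fun f : D => (f : Ω → ℝ)) (fun f => Q f) Y v := ⟨v, h⟩
      simp only [P, dif_pos hex]
      exact hQ.represents_unique hex.choose_spec h
    refine ⟨P, fun f hf => hP (represents_self _ (fun f : D => Q f) ⟨f, hf⟩),
      fun Y n F α hF hY hwell => hP (rep Y n F α hF hY hwell), ?_⟩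
    intro n idx γ c htop hbot hc
    have hidx (k) : Represents (fun f : D => (f : Ω → ℝ)) (fun f => Q f) (idx k) (P (idx k)) := by
      obtain ⟨m, F, α, hF, hY, hwell⟩ := (idx k).2
      have h := rep _ m F α hF hY hwell
      rwa [hP h]
    simpa [indicatorRV] using hQ.iSup_represents_nonneg _ _ hidx γ c htop hbot hc
  · intro Y n F α hF hY hwell p hp hcoh
    have hB : adjoinB (fun _ : D => (Set.univ : Set Ω)) Set.univ = fun _ => Set.univ := by
      ext1 o
      cases o <;> rfl
    rw [hB] at hcoh
    exact hp (hcoh.represents_unique (represents_self _ (adjoinP (fun f : D => Q f) p) none)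
      ⟨n, fun j => some ⟨F j, hF j⟩, α, hY, hwell, rfl⟩)

end
end

section
/- Let P be a coherent₁ collection of marginal previsions on a linear space 𝓛 of real-valued functions on Ω that contains all constant functions. Then P is a finitely additive expectation on 𝓛: P(1) = 1, P is nonnegative, and P is extended-linear. -/
open scoped BigOperators

noncomputable section

/-- The real price `c` is admissible for trading `a` units at prevision `p`: bought at no more
than `p` when `a` is nonnegative, sold at no less than `p` when `a` is nonpositive. -/
def AdmissiblePrice (a c : ℝ) (p : EReal) : Prop :=
  (0 ≤ a ∧ (c : EReal) ≤ p) ∨ (a ≤ 0 ∧ p ≤ c)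

lemma AdmissiblePrice.exists_fair {a c : ℝ} {p : EReal} (h : AdmissiblePrice a c p) :
    ∃ c' : ℝ, a * c ≤ a * c' ∧ (p = ⊤ → 0 ≤ a) ∧ (p = ⊥ → a ≤ 0) ∧
      (p ≠ ⊤ → p ≠ ⊥ → (c' : EReal) = p) := by
  induction p with
  | bot => exact ⟨c, le_rfl, by simp, by simpa [AdmissiblePrice] using h, by simp⟩
  | top => exact ⟨c, le_rfl, by simpa [AdmissiblePrice] using h, by simp, by simp⟩
  | coe p =>
    refine ⟨p, ?_, by simp, by simp, by simp⟩
    rcases h with ⟨ha, h⟩ | ⟨ha, h⟩ <;> rw [EReal.coe_le_coe_iff] at h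
    · exact mul_le_mul_of_nonneg_left h ha
    · exact mul_le_mul_of_nonpos_left h ha

lemma AdmissiblePrice.exists_of_lt_mul {a u : ℝ} {p : EReal} (h : (u : EReal) < a * p) :
    ∃ c : ℝ, AdmissiblePrice a c p ∧ u ≤ a * c := by
  rcases lt_trichotomy a 0 with ha | rfl | ha
  · induction p with
    | bot => exact ⟨u / a, .inr ⟨ha.le, bot_le⟩, (mul_div_cancel₀ u ha.ne).ge⟩
    | top => simp [EReal.coe_mul_top_of_neg ha] at h
    | coe p => exact ⟨p, .inr ⟨ha.le, le_rfl⟩, by exact_mod_cast h.le⟩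
  · refine ⟨0, ?_, ?_⟩
    · rcases le_total (0 : EReal) p with hp | hp
      · exact .inl ⟨le_rfl, by simpa using hp⟩
      · exact .inr ⟨le_rfl, by simpa using hp⟩
    · rw [EReal.coe_zero, zero_mul] at h
      simpa using (EReal.coe_neg'.1 h).le
  · induction p with
    | bot => simp [EReal.coe_mul_bot_of_pos ha] at h
    | top => exact ⟨u / a, .inl ⟨ha.le, le_top⟩, (mul_div_cancel₀ u ha.ne').ge⟩
    | coe p => exact ⟨p, .inl ⟨ha.le, le_rfl⟩, by exact_mod_cast h.le⟩

lemma AdmissiblePrice.exists_of_mul_lt {a u : ℝ} {p : EReal} (h : (a : EReal) * p < u) :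
    ∃ c : ℝ, AdmissiblePrice (-a) c p ∧ a * c ≤ u := by
  have h' : ((-u : ℝ) : EReal) < ((-a : ℝ) : EReal) * p := by
    rw [EReal.coe_neg, EReal.coe_neg, EReal.neg_mul]
    exact EReal.neg_lt_neg_iff.2 h
  obtain ⟨c, hc, hu⟩ := exists_of_lt_mul h'
  exact ⟨c, hc, by linarith⟩

/-- Under coherence, a combination of marginal gambles bounded above by `d` has total admissible
price at most `d`. -/
lemma Coherent1.sum_price_le {Ω I : Type*} [Nonempty Ω] {X : I → Ω → ℝ} {P : I → EReal}
    (hP : Coherent1 X (fun _ => Set.univ) P) {n : ℕ} (idx : Fin n → I) {α c : Fin n → ℝ} {d : ℝ}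
    (hc : ∀ j, AdmissiblePrice (α j) (c j) (P (idx j)))
    (hd : ∀ ω, ∑ j, α j * X (idx j) ω ≤ d) : ∑ j, α j * c j ≤ d := by
  choose c' hle htop hbot hfin using fun j => (hc j).exists_fair
  refine (Finset.sum_le_sum fun j _ => hle j).trans ?_
  have hsup : (0 : EReal) ≤ ((d - ∑ j, α j * c' j : ℝ) : EReal) := by
    refine (hP n idx α c' htop hbot hfin).trans (iSup_le fun ω => EReal.coe_le_coe_iff.2 ?_)
    simpa [indicatorRV, mul_sub] using hd ω
  exact sub_nonneg.1 (EReal.coe_nonneg.1 hsup)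

/-- A coherent₁ collection of marginal previsions `P` on a linear space `L` of
real-valued functions on `Ω` containing all constants is a finitely additive
expectation: `P 1 = 1`, `P` is nonnegative (monotone), and `P` is extended-linear
whenever the right-hand side of the linearity equation is well defined
(not `∞ - ∞`, with `(0 : EReal) * ⊤ = 0` and `(0 : EReal) * ⊥ = 0`). -/
theorem coherent1_is_fae {Ω : Type*} [Nonempty Ω] (L : Set (Ω → ℝ))
    (hconst : ∀ c : ℝ, (fun _ => c) ∈ L)
    (hadd : ∀ X ∈ L, ∀ Y ∈ L, (fun ω => X ω + Y ω) ∈ L)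
    (hsmul : ∀ (a : ℝ), ∀ X ∈ L, (fun ω => a * X ω) ∈ L)
    (P : (Ω → ℝ) → EReal)
    (hP : Coherent1 (fun f : L => (f : Ω → ℝ)) (fun _ => (Set.univ : Set Ω))
      (fun f => P f)) :
    P (fun _ => 1) = 1 ∧
    (∀ X ∈ L, ∀ Y ∈ L, (∀ ω, X ω ≤ Y ω) → P X ≤ P Y) ∧
    (∀ (a b : ℝ), ∀ X ∈ L, ∀ Y ∈ L,
      ¬(((a : EReal) * P X = ⊤ ∧ (b : EReal) * P Y = ⊥) ∨
        ((a : EReal) * P X = ⊥ ∧ (b : EReal) * P Y = ⊤)) →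
      P (fun ω => a * X ω + b * Y ω) = (a : EReal) * P X + (b : EReal) * P Y) := by
  have key : ∀ (X : L) (Y : L) (Z : L) (a b e x y z d : ℝ), AdmissiblePrice a x (P X) →
      AdmissiblePrice b y (P Y) → AdmissiblePrice e z (P Z) →
      (∀ ω, a * X.1 ω + b * Y.1 ω + e * Z.1 ω ≤ d) → a * x + b * y + e * z ≤ d := by
    intro X Y Z a b e x y z d hx hy hz hd
    have := hP.sum_price_le ![X, Y, Z] (α := ![a, b, e]) (c := ![x, y, z]) (d := d)
      (by simp [Fin.forall_fin_succ, hx, hy, hz])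
      (fun ω => by simpa [Fin.sum_univ_three] using hd ω)
    simpa [Fin.sum_univ_three] using this
  have lower : ∀ (X : L) (Y : L) (Z : L) (a b x y : ℝ), AdmissiblePrice a x (P X) →
      AdmissiblePrice b y (P Y) → (∀ ω, a * X.1 ω + b * Y.1 ω ≤ Z.1 ω) →
      ((a * x + b * y : ℝ) : EReal) ≤ P Z := by
    intro X Y Z a b x y hx hy hZ
    refine EReal.le_of_forall_lt_iff_le.1 fun z hz => EReal.coe_le_coe_iff.2 ?_
    have := key X Y Z a b (-1) x y z 0 hx hy (.inr ⟨by norm_num, hz.le⟩)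
      fun ω => by linarith [hZ ω]
    linarith
  have upper : ∀ (X : L) (Y : L) (Z : L) (a b x y : ℝ), AdmissiblePrice (-a) x (P X) →
      AdmissiblePrice (-b) y (P Y) → (∀ ω, Z.1 ω ≤ a * X.1 ω + b * Y.1 ω) →
      P Z ≤ ((a * x + b * y : ℝ) : EReal) := by
    intro X Y Z a b x y hx hy hZ
    refine EReal.ge_of_forall_gt_iff_ge.1 fun z hz => EReal.coe_le_coe_iff.2 ?_
    have := key X Y Z (-a) (-b) 1 x y z 0 hx hy (.inl ⟨by norm_num, hz.le⟩)
      fun ω => by linarith [hZ ω]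
    linarith
  refine ⟨?_, ?_, ?_⟩
  · let U : L := ⟨fun _ => 1, hconst 1⟩
    have hzero : ∀ c : ℝ, AdmissiblePrice 0 c (P U) := fun c =>
      (le_total (c : EReal) (P U)).imp (⟨le_rfl, ·⟩) (⟨le_rfl, ·⟩)
    refine le_antisymm ?_ ?_
    · refine EReal.ge_of_forall_gt_iff_ge.1 fun z hz => ?_
      have := key U U U 1 0 0 z 0 0 1 (.inl ⟨by norm_num, hz.le⟩) (hzero 0) (hzero 0)
        fun ω => by simp [U]
      exact_mod_cast (by linarith : z ≤ 1)
    · refine EReal.le_of_forall_lt_iff_le.1 fun z hz => ?_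
      have := key U U U (-1) 0 0 z 0 0 (-1) (.inr ⟨by norm_num, hz.le⟩) (hzero 0) (hzero 0)
        fun ω => by simp [U]
      exact_mod_cast (by linarith : 1 ≤ z)
  · intro X hX Y hY hXY
    refine EReal.ge_of_forall_gt_iff_ge.1 fun z hz => ?_
    simpa using lower ⟨X, hX⟩ ⟨X, hX⟩ ⟨Y, hY⟩ 1 0 z z (.inl ⟨zero_le_one, hz.le⟩)
      (.inl ⟨le_rfl, hz.le⟩) fun ω => by simpa using hXY ω
  · intro a b X hX Y hY hwd
    let Z : L := ⟨fun ω => a * X ω + b * Y ω, hadd _ (hsmul a X hX) _ (hsmul b Y hY)⟩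
    rw [not_or, not_and_or, not_and_or] at hwd
    refine le_antisymm ?_ ?_
    · refine EReal.le_add_of_forall_gt hwd.2 hwd.1 fun u hu v hv => ?_
      obtain ⟨u', hu', huu⟩ := EReal.lt_iff_exists_real_btwn.1 hu
      obtain ⟨v', hv', hvv⟩ := EReal.lt_iff_exists_real_btwn.1 hv
      obtain ⟨x, hx, hxu⟩ := AdmissiblePrice.exists_of_mul_lt hu'
      obtain ⟨y, hy, hyv⟩ := AdmissiblePrice.exists_of_mul_lt hv'
      calc P Z ≤ ((a * x + b * y : ℝ) : EReal) :=
            upper ⟨X, hX⟩ ⟨Y, hY⟩ Z a b x y hx hy fun _ => le_rfl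
        _ ≤ ((u' + v' : ℝ) : EReal) := EReal.coe_le_coe_iff.2 (add_le_add hxu hyv)
        _ = u' + v' := EReal.coe_add _ _
        _ ≤ u + v := add_le_add huu.le hvv.le
    · refine EReal.add_le_of_forall_lt fun u hu v hv => ?_
      obtain ⟨u', huu, hu'⟩ := EReal.lt_iff_exists_real_btwn.1 hu
      obtain ⟨v', hvv, hv'⟩ := EReal.lt_iff_exists_real_btwn.1 hv
      obtain ⟨x, hx, hxu⟩ := AdmissiblePrice.exists_of_lt_mul hu'
      obtain ⟨y, hy, hyv⟩ := AdmissiblePrice.exists_of_lt_mul hv'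
      calc u + v ≤ u' + v' := add_le_add huu.le hvv.le
        _ = ((u' + v' : ℝ) : EReal) := (EReal.coe_add _ _).symm
        _ ≤ ((a * x + b * y : ℝ) : EReal) := EReal.coe_le_coe_iff.2 (add_le_add hxu hyv)
        _ ≤ P Z := lower ⟨X, hX⟩ ⟨Y, hY⟩ Z a b x y hx hy fun _ => le_rfl

end
end

section
/- Let 𝒟 = {(X_i, B_i): i ∈ I} be a collection of random variable/nonempty event pairs with coherent₁ conditional previsions {P(X_i|B_i): i ∈ I}, and let (X, B) be a random variable/nonempty event pair such that the pairs (1_B, Ω) and (X·1_B, Ω) belong to 𝒟 with P(B) = 0 and P(X·1_B) ≠ 0. Then the unique extended-real value p such that adjoining the conditional prevision P(X|B) = p to the collection remains coherent₁ is the infinite value (+∞ or −∞) with the same sign as P(X·1_B). -/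
open scoped BigOperators

noncomputable section

theorem Coherent1.iSup_sum_nonneg {Ω I κ : Type*} [Fintype κ] {X : I → Ω → ℝ} {B : I → Set Ω}
    {P : I → EReal} (h : Coherent1 X B P) (idx : κ → I) (α c : κ → ℝ)
    (htop : ∀ j, P (idx j) = ⊤ → 0 ≤ α j) (hbot : ∀ j, P (idx j) = ⊥ → α j ≤ 0)
    (hc : ∀ j, P (idx j) ≠ ⊤ → P (idx j) ≠ ⊥ → (c j : EReal) = P (idx j)) :
    0 ≤ ⨆ ω, ((∑ j, α j * indicatorRV (B (idx j)) ω * (X (idx j) ω - c j) : ℝ) : EReal) := by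
  let e := (Fintype.equivFin κ).symm
  refine (h _ (idx ∘ e) (α ∘ e) (c ∘ e) (fun _ => htop _) (fun _ => hbot _)
    (fun _ => hc _)).trans_eq (iSup_congr fun ω => ?_)
  exact congrArg _ (e.sum_comp fun j => α j * indicatorRV (B (idx j)) ω * (X (idx j) ω - c j))

theorem indicatorRV_univ {Ω : Type*} (ω : Ω) : indicatorRV Set.univ ω = 1 := by
  simp [indicatorRV]

/-- A real price for a prevision, of the same sign as the prevision. -/
theorem EReal.exists_price {q : EReal} (hq : q ≠ 0) :
    ∃ c : ℝ, (q ≠ ⊤ → q ≠ ⊥ → (c : EReal) = q) ∧ (0 < q → 0 < c) ∧ (¬ 0 < q → c < 0) := by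
  induction q with
  | bot => exact ⟨-1, by simp⟩
  | top => exact ⟨1, by simp⟩
  | coe r =>
    refine ⟨r, fun _ _ => rfl, fun h => by exact_mod_cast h, fun h => ?_⟩
    exact lt_of_le_of_ne (by exact_mod_cast not_lt.1 h) (by exact_mod_cast hq)

/-- The conditional prevision `p` may be adjoined when every stake admissible for it is an
admissible stake on `Z·1_C` with nonnegative price. -/
theorem Coherent1.adjoin {Ω I : Type*} {X : I → Ω → ℝ} {B : I → Set Ω} {P : I → EReal}
    (hcoh : Coherent1 X B P) {Z : Ω → ℝ} {C : Set Ω} {iB iZB : I}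
    (hiB₁ : X iB = indicatorRV C) (hiB₂ : B iB = Set.univ)
    (hiZB₁ : X iZB = fun ω => Z ω * indicatorRV C ω) (hiZB₂ : B iZB = Set.univ)
    (hzero : P iB = 0) {q : ℝ} (hq : P iZB ≠ ⊤ → P iZB ≠ ⊥ → (q : EReal) = P iZB) {p : EReal}
    (hstake : ∀ a : ℝ, (p = ⊤ → 0 ≤ a) → (p = ⊥ → a ≤ 0) →
      (P iZB = ⊤ → 0 ≤ a) ∧ (P iZB = ⊥ → a ≤ 0) ∧ 0 ≤ a * q) :
    Coherent1 (adjoinX X Z) (adjoinB B C) (adjoinP P p) := by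
  intro n idx α c htop hbot hc
  have key := hcoh.iSup_sum_nonneg (κ := Fin n ⊕ Fin n)
    (Sum.elim (fun j => (idx j).getD iB) fun _ => iZB)
    (Sum.elim (fun j => (idx j).elim (-(α j * c j)) fun _ => α j)
      fun j => (idx j).elim (α j) fun _ => 0)
    (Sum.elim (fun j => (idx j).elim 0 fun _ => c j) fun _ => q)
    (by
      rintro (j | j) <;> have := htop j <;> have hb := hbot j <;>
        rcases hj : idx j with _ | i <;> simp_all [adjoinP])
    (by
      rintro (j | j) <;> have := htop j <;> have hb := hbot j <;>
        rcases hj : idx j with _ | i <;> simp_all [adjoinP])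
    (by
      rintro (j | j)
      · have := hc j
        rcases hj : idx j with _ | i <;> simp_all [adjoinP]
      · simpa using hq)
  refine key.trans (iSup_mono fun ω => EReal.coe_le_coe_iff.2 ?_)
  rw [Fintype.sum_sum_type, ← Finset.sum_add_distrib]
  refine Finset.sum_le_sum fun j _ => ?_
  have ht := htop j
  have hb := hbot j
  rcases hj : idx j with _ | i
  · rw [hj] at ht hb
    have := (hstake (α j) ht hb).2.2
    simp only [Sum.elim_inl, Sum.elim_inr, hj, Option.getD_none, Option.elim_none, hiB₁, hiB₂,
      hiZB₁, hiZB₂, indicatorRV_univ, adjoinB, adjoinX]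
    linarith
  · simp [hj, adjoinB, adjoinX]

/-- If some stake `a` on `Z·1_C` with positive total price can be admissibly offset by the stake
`-a` on `Z` given `C`, the adjoined collection incurs a sure loss. -/
theorem not_coherent1_adjoin {Ω I : Type*} {X : I → Ω → ℝ} {B : I → Set Ω} {P : I → EReal}
    {Z : Ω → ℝ} {C : Set Ω} {iB iZB : I}
    (hiB₁ : X iB = indicatorRV C) (hiB₂ : B iB = Set.univ)
    (hiZB₁ : X iZB = fun ω => Z ω * indicatorRV C ω) (hiZB₂ : B iZB = Set.univ)
    (hzero : P iB = 0) {q : ℝ} (hq : P iZB ≠ ⊤ → P iZB ≠ ⊥ → (q : EReal) = P iZB) {p : EReal}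
    {a : ℝ} (ha : 0 < a * q) (htop : P iZB = ⊤ → 0 ≤ a) (hbot : P iZB = ⊥ → a ≤ 0)
    (hptop : p = ⊤ → a ≤ 0) (hpbot : p = ⊥ → 0 ≤ a) :
    ¬ Coherent1 (adjoinX X Z) (adjoinB B C) (adjoinP P p) := by
  intro h
  have key := h 3 ![none, some iZB, some iB] ![-a, a, -(a * p.toReal)] ![p.toReal, q, 0]
    (by simpa [Fin.forall_fin_succ, adjoinP, hzero] using ⟨hptop, htop⟩)
    (by simpa [Fin.forall_fin_succ, adjoinP, hzero] using ⟨hpbot, hbot⟩)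
    (by simpa [Fin.forall_fin_succ, adjoinP, hzero] using
      ⟨fun h₁ h₂ => EReal.coe_toReal h₁ h₂, hq⟩)
  refine absurd (key.trans (iSup_le fun ω => EReal.coe_le_coe_iff.2 (?_ : _ ≤ -(a * q)))) ?_
  · simp only [Fin.sum_univ_three, Matrix.cons_val, adjoinB, adjoinX, Option.elim_none,
      Option.elim_some, hiB₁, hiB₂, hiZB₁, hiZB₂, indicatorRV_univ]
    linarith
  · exact not_le.2 (by exact_mod_cast neg_neg_of_pos ha)

/-- If a coherent₁ collection of conditional previsions contains the marginal
previsions `P(1_C) = 0` and `P(Z·1_C) ≠ 0`, then the unique extended-real value `p`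
such that adjoining the conditional prevision `P(Z|C) = p` keeps the collection
coherent₁ is the infinite value with the same sign as `P(Z·1_C)`. -/
theorem conditional_prevision_of_zero_nonzero {Ω I : Type*} [Nonempty Ω]
    (X : I → Ω → ℝ) (B : I → Set Ω) (hBne : ∀ i, (B i).Nonempty) (P : I → EReal)
    (hcoh : Coherent1 X B P)
    (Z : Ω → ℝ) (C : Set Ω) (hC : C.Nonempty)
    (iB iZB : I)
    (hiB₁ : X iB = indicatorRV C) (hiB₂ : B iB = Set.univ)
    (hiZB₁ : X iZB = fun ω => Z ω * indicatorRV C ω) (hiZB₂ : B iZB = Set.univ)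
    (hzero : P iB = 0) (hne : P iZB ≠ 0) :
    ∀ p : EReal,
      Coherent1 (adjoinX X Z) (adjoinB B C) (adjoinP P p) ↔
        p = (if 0 < P iZB then (⊤ : EReal) else ⊥) := by
  intro p
  obtain ⟨q, hq, hpos, hneg⟩ := EReal.exists_price hne
  split_ifs with h
  · have hbot : P iZB ≠ ⊥ := (bot_le.trans_lt h).ne'
    refine ⟨fun hp => ?_, ?_⟩
    · by_contra hpt
      exact not_coherent1_adjoin hiB₁ hiB₂ hiZB₁ hiZB₂ hzero hq (a := 1) (by simpa using hpos h)
        (by simp) (fun h' => absurd h' hbot) (fun h' => absurd h' hpt) (by simp) hp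
    · rintro rfl
      exact hcoh.adjoin hiB₁ hiB₂ hiZB₁ hiZB₂ hzero hq fun a ha _ =>
        ⟨fun _ => ha rfl, fun h' => absurd h' hbot, mul_nonneg (ha rfl) (hpos h).le⟩
  · have htop : P iZB ≠ ⊤ := fun h' => h (by simp [h'])
    refine ⟨fun hp => ?_, ?_⟩
    · by_contra hpb
      exact not_coherent1_adjoin hiB₁ hiB₂ hiZB₁ hiZB₂ hzero hq (a := -1) (by simpa using hneg h)
        (fun h' => absurd h' htop) (by simp) (by simp) (fun h' => absurd h' hpb) hp
    · rintro rfl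
      exact hcoh.adjoin hiB₁ hiB₂ hiZB₁ hiZB₂ hzero hq fun a _ ha =>
        ⟨fun h' => absurd h' htop, fun _ => ha rfl,
          mul_nonneg_of_nonpos_of_nonpos (ha rfl) (hneg h).le⟩

end
end

section
/- Let 𝒟 = {(X_i, B_i): i ∈ I} be a collection of random variable/nonempty event pairs with coherent₁ conditional previsions {P(X_i|B_i): i ∈ I}, and let (X, B) be a random variable/nonempty event pair such that the pairs (1_B, Ω) and (X·1_B, Ω) belong to 𝒟 with P(B) = 0 and P(X·1_B) = 0. Then for every extended-real number c, adjoining the conditional prevision P(X|B) = c to the collection remains coherent₁. -/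
open scoped BigOperators

noncomputable section

/-- If a coherent₁ collection of conditional previsions contains the marginal
previsions `P(1_C) = 0` and `P(Z·1_C) = 0`, then adjoining the conditional prevision
`P(Z|C) = c` keeps the collection coherent₁ for every extended-real number `c`. -/
theorem conditional_prevision_of_zero_zero {Ω I : Type*} [Nonempty Ω]
    (X : I → Ω → ℝ) (B : I → Set Ω) (hBne : ∀ i, (B i).Nonempty) (P : I → EReal)
    (hcoh : Coherent1 X B P)
    (Z : Ω → ℝ) (C : Set Ω) (hC : C.Nonempty)
    (iB iZB : I)
    (hiB₁ : X iB = indicatorRV C) (hiB₂ : B iB = Set.univ)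
    (hiZB₁ : X iZB = fun ω => Z ω * indicatorRV C ω) (hiZB₂ : B iZB = Set.univ)
    (hzeroB : P iB = 0) (hzeroZB : P iZB = 0) :
    ∀ c : EReal,
      Coherent1 (adjoinX X Z) (adjoinB B C) (adjoinP P c) := by
  intro c n idx α p hα_top hα_bot hp
  let idx₁ : Fin n → I := fun j => (idx j).getD iZB
  let p₁ : Fin n → ℝ := fun j => (idx j).elim 0 fun _ => p j
  let α₂ : Fin n → ℝ := fun j => (idx j).elim (-(α j * p j)) fun _ => 0
  have h := hcoh (n + n) (Fin.append idx₁ fun _ => iB) (Fin.append α α₂) (Fin.append p₁ fun _ => 0)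
    (fun j => ?top) (fun j => ?bot) (fun j => ?price)
  case top =>
    refine Fin.addCases (fun j => ?_) (fun j => ?_) j
    · have := hα_top j
      cases hj : idx j <;> simp_all [idx₁, adjoinP]
    · simp only [Fin.append_right]; simp [hzeroB]
  case bot =>
    refine Fin.addCases (fun j => ?_) (fun j => ?_) j
    · have := hα_bot j
      cases hj : idx j <;> simp_all [idx₁, adjoinP]
    · simp only [Fin.append_right]; simp [hzeroB]
  case price =>
    refine Fin.addCases (fun j => ?_) (fun j => ?_) j
    · have := hp j
      cases hj : idx j <;> simp_all [idx₁, p₁, adjoinP]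
    · simp only [Fin.append_right]; simp [hzeroB]
  convert h using 4 with ω
  simp only [Fin.sum_univ_add, Fin.append_left, Fin.append_right, ← Finset.sum_add_distrib]
  refine Finset.sum_congr rfl fun j _ => ?_
  cases hj : idx j
  · simp [idx₁, p₁, α₂, hj, adjoinX, adjoinB, hiB₁, hiB₂, hiZB₁, hiZB₂, indicatorRV]
    ring
  · simp [idx₁, p₁, α₂, hj, adjoinX, adjoinB]

end
end

section
/- Let 𝒟 = {(X_i, B_i): i ∈ I} be a collection of random variable/nonempty event pairs with coherent₁ conditional previsions {P(X_i|B_i): i ∈ I}, and let X be a random variable. Then there exist extended reals a ≤ b such that, for every extended real p, adjoining the marginal prevision P(X) = p to the collection remains coherent₁ if and only if a ≤ p ≤ b. (In particular, the set of coherent₁ values for P(X) is a nonempty closed interval of the extended reals.) -/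
open scoped BigOperators

noncomputable section

/-- The coefficient `α` and the price `c` are allowed in a bet on a random variable
with prevision `p`. -/
def AdmissibleBet (p : EReal) (α c : ℝ) : Prop :=
  (p = ⊤ → 0 ≤ α) ∧ (p = ⊥ → α ≤ 0) ∧ (p ≠ ⊤ → p ≠ ⊥ → (c : EReal) = p)

/-- The acceptable gambles on a single conditional prevision. -/
def elementaryGambles {Ω I : Type*} (X : I → Ω → ℝ) (B : I → Set Ω) (P : I → EReal) :
    Set (Ω → ℝ) :=
  {g | ∃ i α c, AdmissibleBet (P i) α c ∧ g = fun ω => α * indicatorRV (B i) ω * (X i ω - c)}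

/-- The finite sums of elementary gambles. -/
def acceptableGambles {Ω I : Type*} (X : I → Ω → ℝ) (B : I → Set Ω) (P : I → EReal) :
    AddSubmonoid (Ω → ℝ) :=
  AddSubmonoid.closure (elementaryGambles X B P)

namespace AdmissibleBet

theorem smul {p : EReal} {α c : ℝ} (h : AdmissibleBet p α c) {t : ℝ} (ht : 0 ≤ t) :
    AdmissibleBet p (t * α) c :=
  ⟨fun hp => mul_nonneg ht (h.1 hp), fun hp => mul_nonpos_of_nonneg_of_nonpos ht (h.2.1 hp), h.2.2⟩

theorem exists_zero (p : EReal) : ∃ c, AdmissibleBet p 0 c :=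
  ⟨p.toReal, fun _ => le_rfl, fun _ => le_rfl, fun h h' => EReal.coe_toReal h h'⟩

theorem exists_add {p : EReal} {α c α' c' : ℝ} (h : AdmissibleBet p α c)
    (h' : AdmissibleBet p α' c') :
    ∃ d, AdmissibleBet p (α + α') d ∧ (α + α') * d = α * c + α' * c' := by
  induction p with
  | coe x =>
    have hc : c = x := by simpa using h.2.2
    have hc' : c' = x := by simpa using h'.2.2
    exact ⟨x, by simp [AdmissibleBet], by rw [hc, hc']; ring⟩
  | top =>
    have hα := h.1 rfl
    have hα' := h'.1 rfl
    refine ⟨(α * c + α' * c') / (α + α'), ⟨fun _ => by positivity, by simp, by simp⟩, ?_⟩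
    rcases eq_or_ne (α + α') 0 with h0 | h0
    · obtain rfl : α = 0 := by linarith
      obtain rfl : α' = 0 := by linarith
      simp
    · field_simp
  | bot =>
    have hα := h.2.1 rfl
    have hα' := h'.2.1 rfl
    refine ⟨(α * c + α' * c') / (α + α'), ⟨by simp, fun _ => by linarith, by simp⟩, ?_⟩
    rcases eq_or_ne (α + α') 0 with h0 | h0
    · obtain rfl : α = 0 := by linarith
      obtain rfl : α' = 0 := by linarith
      simp
    · field_simp

theorem coe_le {p : EReal} {α c : ℝ} (h : AdmissibleBet p α c) (hα : 0 < α) : (c : EReal) ≤ p := by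
  by_cases ht : p = ⊤
  · simp [ht]
  · exact (h.2.2 ht fun hb => hα.not_ge (h.2.1 hb)).le

theorem le_coe {p : EReal} {α c : ℝ} (h : AdmissibleBet p α c) (hα : α < 0) : p ≤ (c : EReal) := by
  by_cases hb : p = ⊥
  · simp [hb]
  · exact (h.2.2 (fun ht => hα.not_ge (h.1 ht)) hb).ge

theorem exists_one {p : EReal} {u : ℝ} (hu : (u : EReal) < p) :
    ∃ c, u < c ∧ AdmissibleBet p 1 c := by
  induction p with
  | coe x => exact ⟨x, by simpa using hu, by simp [AdmissibleBet]⟩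
  | top => exact ⟨u + 1, by simp, by simp [AdmissibleBet]⟩
  | bot => simp at hu

theorem exists_neg_one {p : EReal} {l : ℝ} (hl : p < (l : EReal)) :
    ∃ c, c < l ∧ AdmissibleBet p (-1) c := by
  induction p with
  | coe x => exact ⟨x, by simpa using hl, by simp [AdmissibleBet]⟩
  | top => simp at hl
  | bot => exact ⟨l - 1, by simp, by simp [AdmissibleBet]⟩

end AdmissibleBet

theorem smul_mem_acceptableGambles {Ω I : Type*} {X : I → Ω → ℝ} {B : I → Set Ω} {P : I → EReal}
    {g : Ω → ℝ} (hg : g ∈ acceptableGambles X B P) {t : ℝ} (ht : 0 ≤ t) :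
    t • g ∈ acceptableGambles X B P := by
  refine AddSubmonoid.closure_induction (motive := fun g _ => t • g ∈ acceptableGambles X B P)
    ?_ ?_ ?_ hg
  · rintro _ ⟨i, α, c, h, rfl⟩
    refine AddSubmonoid.subset_closure ⟨i, t * α, c, h.smul ht, ?_⟩
    ext ω
    simp only [Pi.smul_apply, smul_eq_mul]
    ring
  · simp
  · intro f g _ _ hf hg
    rw [smul_add]
    exact add_mem hf hg

theorem coherent1_iff_forall_mem_acceptableGambles {Ω I : Type*} {X : I → Ω → ℝ} {B : I → Set Ω}
    {P : I → EReal} :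
    Coherent1 X B P ↔ ∀ g ∈ acceptableGambles X B P, 0 ≤ ⨆ ω, ((g ω : ℝ) : EReal) := by
  constructor
  · intro h g hg
    obtain ⟨l, hl, rfl⟩ := AddSubmonoid.exists_list_of_mem_closure hg
    choose idx α c hadm hval using fun j : Fin l.length => hl (l.get j) (l.get_mem j)
    convert h l.length idx α c (fun j => (hadm j).1) (fun j => (hadm j).2.1)
      (fun j => (hadm j).2.2) using 4 with ω
    rw [← Fin.sum_univ_getElem l, Finset.sum_apply]
    exact Finset.sum_congr rfl fun j _ => congrFun (hval j) ω
  · intro h n idx α c h1 h2 h3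
    have hmem : ∑ j, (fun ω => α j * indicatorRV (B (idx j)) ω * (X (idx j) ω - c j)) ∈
        acceptableGambles X B P :=
      sum_mem fun j _ => AddSubmonoid.subset_closure ⟨idx j, α j, c j, ⟨h1 j, h2 j, h3 j⟩, rfl⟩
    simpa only [Finset.sum_apply] using h _ hmem

theorem mem_acceptableGambles_adjoin_iff {Ω I : Type*} {X : I → Ω → ℝ} {B : I → Set Ω}
    {P : I → EReal} {Z : Ω → ℝ} {p : EReal} {f : Ω → ℝ} :
    f ∈ acceptableGambles (adjoinX X Z) (adjoinB B (Set.univ : Set Ω)) (adjoinP P p) ↔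
      ∃ g ∈ acceptableGambles X B P, ∃ α c, AdmissibleBet p α c ∧
        f = fun ω => g ω + α * (Z ω - c) := by
  constructor
  · intro hf
    refine AddSubmonoid.closure_induction (motive := fun f _ => ∃ g ∈ acceptableGambles X B P,
      ∃ α c, AdmissibleBet p α c ∧ f = fun ω => g ω + α * (Z ω - c)) ?_ ?_ ?_ hf
    · rintro _ ⟨_ | i, α, c, h, rfl⟩
      · exact ⟨0, zero_mem _, α, c, h, by ext ω; simp [adjoinX, adjoinB, indicatorRV]⟩
      · obtain ⟨d, hd⟩ := AdmissibleBet.exists_zero p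
        exact ⟨_, AddSubmonoid.subset_closure ⟨i, α, c, h, rfl⟩, 0, d, hd,
          by ext ω; simp [adjoinX, adjoinB]⟩
    · obtain ⟨d, hd⟩ := AdmissibleBet.exists_zero p
      exact ⟨0, zero_mem _, 0, d, hd, by ext ω; simp⟩
    · rintro _ _ _ _ ⟨g, hg, α, c, h, rfl⟩ ⟨g', hg', α', c', h', rfl⟩
      obtain ⟨d, hd, hsum⟩ := h.exists_add h'
      refine ⟨g + g', add_mem hg hg', α + α', d, hd, ?_⟩
      ext ω
      simp only [Pi.add_apply]
      linear_combination hsum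
  · rintro ⟨g, hg, α, c, h, rfl⟩
    refine add_mem (S := AddSubmonoid (Ω → ℝ)) (a := g) (b := fun ω => α * (Z ω - c)) ?_ ?_
    · refine AddSubmonoid.closure_mono ?_ hg
      rintro _ ⟨i, α, c, h, rfl⟩
      exact ⟨some i, α, c, h, rfl⟩
    · exact AddSubmonoid.subset_closure
        ⟨none, α, c, h, by ext ω; simp [adjoinX, adjoinB, indicatorRV]⟩

theorem not_zero_le_iSup_coe_iff {Ω : Type*} [Nonempty Ω] {f : Ω → ℝ} :
    ¬ 0 ≤ ⨆ ω, ((f ω : ℝ) : EReal) ↔ ∃ ε > 0, ∀ ω, f ω ≤ -ε := by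
  rw [not_le]
  constructor
  · intro h
    obtain ⟨y, hy, hy0⟩ := EReal.lt_iff_exists_real_btwn.1 h
    exact ⟨-y, by simpa using hy0, fun ω => by
      simpa using (EReal.coe_lt_coe_iff.1 ((le_iSup (fun ω => (f ω : EReal)) ω).trans_lt hy)).le⟩
  · rintro ⟨ε, hε, h⟩
    refine (iSup_le fun ω => EReal.coe_le_coe_iff.2 (h ω)).trans_lt ?_
    exact_mod_cast neg_lt_zero.2 hε

/-- The marginal prices dominating `Z` up to an acceptable gamble. -/
def upperPrices {Ω I : Type*} (X : I → Ω → ℝ) (B : I → Set Ω) (P : I → EReal) (Z : Ω → ℝ) :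
    Set ℝ :=
  {u | ∃ g ∈ acceptableGambles X B P, ∀ ω, Z ω + g ω ≤ u}

/-- The marginal prices dominated by `Z` up to an acceptable gamble. -/
def lowerPrices {Ω I : Type*} (X : I → Ω → ℝ) (B : I → Set Ω) (P : I → EReal) (Z : Ω → ℝ) :
    Set ℝ :=
  {l | ∃ g ∈ acceptableGambles X B P, ∀ ω, l + g ω ≤ Z ω}

theorem Coherent1.lowerPrice_le_upperPrice {Ω I : Type*} [Nonempty Ω] {X : I → Ω → ℝ}
    {B : I → Set Ω} {P : I → EReal} (hcoh : Coherent1 X B P) {Z : Ω → ℝ} {l u : ℝ}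
    (hl : l ∈ lowerPrices X B P Z) (hu : u ∈ upperPrices X B P Z) : l ≤ u := by
  obtain ⟨g, hg, hgl⟩ := hl
  obtain ⟨g', hg', hgu⟩ := hu
  by_contra! hlt
  refine not_zero_le_iSup_coe_iff.2 ⟨l - u, sub_pos.2 hlt, fun ω => ?_⟩
    (coherent1_iff_forall_mem_acceptableGambles.1 hcoh _ (add_mem hg hg'))
  simp only [Pi.add_apply]
  linarith [hgl ω, hgu ω]

theorem Coherent1.adjoin_iff {Ω I : Type*} [Nonempty Ω] {X : I → Ω → ℝ}
    {B : I → Set Ω} {P : I → EReal} (hcoh : Coherent1 X B P) {Z : Ω → ℝ} {p : EReal} :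
    Coherent1 (adjoinX X Z) (adjoinB B (Set.univ : Set Ω)) (adjoinP P p) ↔
      (∀ l ∈ lowerPrices X B P Z, (l : EReal) ≤ p) ∧
        ∀ u ∈ upperPrices X B P Z, p ≤ (u : EReal) := by
  rw [coherent1_iff_forall_mem_acceptableGambles]
  constructor
  · intro h
    constructor
    · rintro l ⟨g, hg, hgl⟩
      by_contra! hlt
      obtain ⟨c, hc, hadm⟩ := AdmissibleBet.exists_neg_one hlt
      refine not_zero_le_iSup_coe_iff.2 ⟨l - c, sub_pos.2 hc, fun ω => ?_⟩
        (h _ (mem_acceptableGambles_adjoin_iff.2 ⟨g, hg, -1, c, hadm, rfl⟩))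
      linarith [hgl ω]
    · rintro u ⟨g, hg, hgu⟩
      by_contra! hlt
      obtain ⟨c, hc, hadm⟩ := AdmissibleBet.exists_one hlt
      refine not_zero_le_iSup_coe_iff.2 ⟨c - u, sub_pos.2 hc, fun ω => ?_⟩
        (h _ (mem_acceptableGambles_adjoin_iff.2 ⟨g, hg, 1, c, hadm, rfl⟩))
      linarith [hgu ω]
  · rintro ⟨hl, hu⟩ f hf
    by_contra hneg
    obtain ⟨g, hg, α, c, hadm, rfl⟩ := mem_acceptableGambles_adjoin_iff.1 hf
    obtain ⟨ε, hε, hle⟩ := not_zero_le_iSup_coe_iff.1 hneg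
    rcases lt_trichotomy α 0 with hα | rfl | hα
    · have hmem : c + ε / -α ∈ lowerPrices X B P Z := by
        refine ⟨(-α)⁻¹ • g, smul_mem_acceptableGambles hg (by simpa using hα.le), fun ω => ?_⟩
        have hα' : 0 < -α := neg_pos.2 hα
        have hdiv : (ε + g ω) / -α ≤ Z ω - c := by
          rw [div_le_iff₀ hα']
          linarith [hle ω]
        rw [add_div] at hdiv
        rw [Pi.smul_apply, smul_eq_mul, inv_mul_eq_div]
        linarith
      have hle' := EReal.coe_le_coe_iff.1 ((hl _ hmem).trans (hadm.le_coe hα))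
      linarith [div_pos hε (neg_pos.2 hα)]
    · refine not_zero_le_iSup_coe_iff.2 ⟨ε, hε, fun ω => ?_⟩
        (coherent1_iff_forall_mem_acceptableGambles.1 hcoh g hg)
      simpa using hle ω
    · have hmem : c - ε / α ∈ upperPrices X B P Z := by
        refine ⟨α⁻¹ • g, smul_mem_acceptableGambles hg (inv_nonneg.2 hα.le), fun ω => ?_⟩
        have hdiv : (ε + g ω) / α ≤ c - Z ω := by
          rw [div_le_iff₀ hα]
          linarith [hle ω]
        rw [add_div] at hdiv
        rw [Pi.smul_apply, smul_eq_mul, inv_mul_eq_div]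
        linarith
      have hle' := EReal.coe_le_coe_iff.1 ((hadm.coe_le hα).trans (hu _ hmem))
      linarith [div_pos hε hα]

/-- Fundamental lemma for extending a coherent₁ collection of conditional previsions
by one marginal prevision: for any random variable `Z` there are extended reals
`a ≤ b` such that adjoining the marginal prevision `P(Z) = p` keeps the collection
coherent₁ exactly when `a ≤ p ≤ b`; that is, the set of coherent₁ values for `P(Z)`
is a nonempty closed interval of the extended reals. -/
theorem fundamental_lemma_interval {Ω I : Type*} [Nonempty Ω]
    (X : I → Ω → ℝ) (B : I → Set Ω) (hBne : ∀ i, (B i).Nonempty) (P : I → EReal)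
    (hcoh : Coherent1 X B P) (Z : Ω → ℝ) :
    ∃ a b : EReal, a ≤ b ∧
      ∀ p : EReal,
        (Coherent1 (adjoinX X Z) (adjoinB B (Set.univ : Set Ω)) (adjoinP P p) ↔
          a ≤ p ∧ p ≤ b) := by
  refine ⟨⨆ l ∈ lowerPrices X B P Z, (l : EReal), ⨅ u ∈ upperPrices X B P Z, (u : EReal), ?_,
    fun p => ?_⟩
  · exact iSup₂_le fun l hl => le_iInf₂ fun u hu =>
      EReal.coe_le_coe_iff.2 (hcoh.lowerPrice_le_upperPrice hl hu)
  · rw [hcoh.adjoin_iff, iSup₂_le_iff, le_iInf₂_iff]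

end
end

section
/- Let Ω be the set of positive integers, let 𝒟 consist of the indicator functions of all singletons {k} for k ≥ 1 with marginal previsions P({k}) = 2^{−k}, and let X be the random variable X(ω) = ω. Then the set of extended-real values p such that adjoining the marginal prevision P(X) = p to this collection remains coherent₁ is exactly the interval [2, ∞] (including p = ∞). -/
open scoped BigOperators

noncomputable section

lemma hasSum_pnat_half_pow : HasSum (fun ω : ℕ+ => (1 / 2 : ℝ) ^ (ω : ℕ)) 1 := by
  rw [← Equiv.pnatEquivNat.symm.hasSum_iff]
  convert (hasSum_geometric_two).mul_left (1 / 2 : ℝ) using 1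
  · rfl
  · ext n
    simp [Equiv.pnatEquivNat, pow_succ, mul_comm]
  · norm_num

lemma hasSum_pnat_half_pow_mul :
    HasSum (fun ω : ℕ+ => (1 / 2 : ℝ) ^ (ω : ℕ) * ((ω : ℕ) : ℝ)) 2 := by
  have h := hasSum_coe_mul_geometric_of_norm_lt_one (r := (1 / 2 : ℝ)) (by norm_num)
  rw [← PNat.coe_injective.hasSum_iff] at h
  · convert h using 1
    · rfl
    · ext n
      simp [mul_comm]
    · norm_num
  · intro n hn
    have : n = 0 := by
      by_contra h0
      exact hn ⟨⟨n, Nat.pos_of_ne_zero h0⟩, rfl⟩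
    simp [this]

lemma hasSum_pnat_half_pow_mul_indicatorRV (k : ℕ+) :
    HasSum (fun ω : ℕ+ => (1 / 2 : ℝ) ^ (ω : ℕ) * indicatorRV ({k} : Set ℕ+) ω)
      ((1 / 2 : ℝ) ^ (k : ℕ)) := by
  convert hasSum_single (f := fun ω : ℕ+ => (1 / 2 : ℝ) ^ (ω : ℕ) *
    indicatorRV ({k} : Set ℕ+) ω) k ?_ using 1
  · simp [indicatorRV]
  · intro ω hω
    simp [indicatorRV, hω]

lemma two_zpow_neg_natCast (k : ℕ) : (2 : ℝ) ^ (-(k : ℤ)) = (1 / 2 : ℝ) ^ k := by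
  simp

lemma sum_range_sub_mul_half_pow (M : ℝ) (N : ℕ) :
    ∑ i ∈ Finset.range N, ((i : ℝ) - M) * (1 / 2 : ℝ) ^ (i + 1) =
      1 - (N + 1) * (1 / 2 : ℝ) ^ N - M * (1 - (1 / 2 : ℝ) ^ N) := by
  induction N with
  | zero => simp
  | succ N ih =>
    rw [Finset.sum_range_succ, ih]
    push_cast
    ring

lemma sum_range_sub_mul_indicatorRV_le (N : ℕ) (ω : ℕ+) :
    ∑ i ∈ Finset.range N, ((i : ℝ) - N) * indicatorRV ({i.succPNat} : Set ℕ+) ω ≤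
      ((ω : ℕ) : ℝ) - 1 - N := by
  obtain ⟨m, rfl⟩ : ∃ m : ℕ, ω = m.succPNat := ⟨ω.natPred, by simp⟩
  have h : ∀ i : ℕ, ((i : ℝ) - N) * indicatorRV ({i.succPNat} : Set ℕ+) m.succPNat =
      if i = m then (i : ℝ) - N else 0 := by
    intro i
    by_cases hi : i = m
    · simp [indicatorRV, hi]
    · have : m.succPNat ≠ i.succPNat := fun e => hi (Nat.succPNat_injective e).symm
      simp [indicatorRV, hi, this]
  simp only [h, Finset.sum_ite_eq', Finset.mem_range]
  split_ifs with hm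
  · simp
  · have : (N : ℝ) ≤ m := by exact_mod_cast not_lt.mp hm
    simpa using this

/-- St. Petersburg-style example: on `Ω = ℕ+`, give the singleton `{k}` the marginal
prevision `2⁻ᵏ` for every `k ≥ 1`, and let `X ω = ω`.  The set of extended-real
values `p` such that adjoining the marginal prevision `P(X) = p` keeps the collection
coherent₁ is exactly the interval `[2, ∞]` (including `p = ⊤`). -/
theorem stPetersburg_prevision_interval :
    ∀ p : EReal,
      Coherent1
        (adjoinX (fun k : ℕ+ => indicatorRV ({k} : Set ℕ+))
          (fun ω : ℕ+ => ((ω : ℕ) : ℝ)))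
        (adjoinB (fun _ : ℕ+ => (Set.univ : Set ℕ+)) (Set.univ : Set ℕ+))
        (adjoinP (fun k : ℕ+ => (((2 : ℝ) ^ (-(k : ℤ)) : ℝ) : EReal)) p) ↔
      (2 : EReal) ≤ p := by
  intro p
  constructor
  · intro H
    by_contra! hp
    have hp2 : p.toReal < 2 := by
      induction p with
      | bot => simp
      | coe r =>
        exact EReal.coe_lt_coe_iff.mp hp
      | top => simp at hp
    have hptop : p ≠ ⊤ := hp.ne_top
    obtain ⟨N, hN⟩ := exists_pow_lt_of_lt_one (sub_pos.mpr hp2) (by norm_num : (1 / 2 : ℝ) < 1)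
    have h := H (N + 1) (Fin.cons none fun i => some (i : ℕ).succPNat)
      (Fin.cons (-1) fun i => (i : ℝ) - N)
      (Fin.cons p.toReal fun i => (1 / 2 : ℝ) ^ ((i : ℕ) + 1)) ?_ ?_ ?_
    · refine absurd h (not_le.mpr ?_)
      refine lt_of_le_of_lt (b := ((p.toReal - 2 + (1 / 2 : ℝ) ^ N : ℝ) : EReal))
        (iSup_le fun ω => ?_) (by exact_mod_cast (by linarith))
      rw [EReal.coe_le_coe_iff, Fin.sum_univ_succ]
      have h₁ := sum_range_sub_mul_half_pow N N
      have h₂ := sum_range_sub_mul_indicatorRV_le N ω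
      rw [← Fin.sum_univ_eq_sum_range (fun i => ((i : ℝ) - N) * (1 / 2 : ℝ) ^ (i + 1))] at h₁
      rw [← Fin.sum_univ_eq_sum_range
        (fun i => ((i : ℝ) - N) * indicatorRV ({i.succPNat} : Set ℕ+) ω)] at h₂
      have hu : indicatorRV (Set.univ : Set ℕ+) ω = 1 := by simp [indicatorRV]
      simp only [Fin.cons_zero, Fin.cons_succ, adjoinX, adjoinB, Option.elim, hu, mul_one,
        mul_sub, Finset.sum_sub_distrib] at h₁ h₂ ⊢
      linarith
    · refine Fin.cases ?_ fun i => ?_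
      · simp [adjoinP, hptop]
      · simp only [Fin.cons_succ, adjoinP, Option.elim]
        exact fun e => absurd e (EReal.coe_ne_top _)
    · refine Fin.cases ?_ fun i => ?_
      · simp
      · simp only [Fin.cons_succ, adjoinP, Option.elim]
        exact fun e => absurd e (EReal.coe_ne_bot _)
    · refine Fin.cases ?_ fun i => ?_
      · intro h₁ h₂
        exact EReal.coe_toReal h₁ h₂
      · intro _ _
        simp only [Fin.cons_succ, adjoinP, Option.elim]
        rw [two_zpow_neg_natCast, Nat.succPNat_coe]
  · intro hp n idx α c hα _ hc
    by_contra! hlt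
    have hu : ∀ ω, indicatorRV (Set.univ : Set ℕ+) ω = 1 := by simp [indicatorRV]
    have hB : ∀ o ω, indicatorRV (adjoinB (fun _ : ℕ+ => (Set.univ : Set ℕ+))
        (Set.univ : Set ℕ+) o) ω = 1 := by
      rintro (_ | k) ω <;> exact hu ω
    simp only [hB, mul_one] at hlt
    set T : Fin n → ℕ+ → ℝ := fun j ω => α j *
      (adjoinX (fun k : ℕ+ => indicatorRV ({k} : Set ℕ+)) (fun ω : ℕ+ => ((ω : ℕ) : ℝ))
        (idx j) ω - c j) with hT
    have hneg : ∀ ω, ∑ j, T j ω < 0 := fun ω => by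
      have h := (le_iSup (fun ω => ((∑ j, T j ω : ℝ) : EReal)) ω).trans_lt hlt
      exact_mod_cast h
    have hcs : ∀ j k, idx j = some k → c j = (1 / 2 : ℝ) ^ (k : ℕ) := fun j k hk => by
      have h := hc j
      rw [hk] at h
      simp only [adjoinP, Option.elim] at h
      rw [← two_zpow_neg_natCast]
      exact_mod_cast h (EReal.coe_ne_top _) (EReal.coe_ne_bot _)
    set a : Fin n → ℝ := fun j => if idx j = none then α j else 0 with ha
    have hsum : ∀ j, HasSum (fun ω : ℕ+ => (1 / 2 : ℝ) ^ (ω : ℕ) * T j ω)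
        (a j * (2 - c j)) := fun j => by
      rcases hk : idx j with _ | k
      · have h := (hasSum_pnat_half_pow_mul.sub (hasSum_pnat_half_pow.mul_right (c j))).mul_left
          (α j)
        convert h using 1
        · rfl
        · ext ω
          simp only [hT, hk, adjoinX, Option.elim]
          ring
        · simp [ha, hk]
      · have h := ((hasSum_pnat_half_pow_mul_indicatorRV k).sub
          (hasSum_pnat_half_pow.mul_right (c j))).mul_left (α j)
        convert h using 1
        · rfl
        · ext ω
          simp only [hT, hk, adjoinX, Option.elim]
          ring
        · simp [ha, hk, hcs j k hk]
    have hexp : ∑ j, a j * (2 - c j) < 0 := by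
      refine hasSum_strict_mono (f := fun ω : ℕ+ => ∑ j, (1 / 2 : ℝ) ^ (ω : ℕ) * T j ω)
        (hasSum_sum fun j _ => hsum j) hasSum_zero ?_
      have hpt : ∀ ω : ℕ+, ∑ j, (1 / 2 : ℝ) ^ (ω : ℕ) * T j ω < 0 := fun ω => by
        rw [← Finset.mul_sum]
        exact mul_neg_of_pos_of_neg (by positivity) (hneg ω)
      exact Pi.lt_def.mpr ⟨fun ω => (hpt ω).le, 1, hpt 1⟩
    have hlow : ∀ j, ∃ C : ℝ, ∀ ω : ℕ+, a j * ((ω : ℕ) : ℝ) - C ≤ T j ω := fun j => by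
      rcases hk : idx j with _ | k
      · refine ⟨α j * c j, fun ω => ?_⟩
        simp only [ha, hT, hk, adjoinX, Option.elim, if_true]
        linarith
      · refine ⟨|α j| + α j * c j, fun ω => ?_⟩
        simp only [ha, hT, hk, adjoinX, Option.elim, reduceCtorEq, if_false]
        have : -|α j| ≤ α j * indicatorRV ({k} : Set ℕ+) ω := by
          by_cases hω : ω = k
          · simp [indicatorRV, hω, neg_abs_le]
          · simp [indicatorRV, hω]
        linarith
    choose C hC using hlow
    have hA : ∑ j, a j ≤ 0 := by
      by_contra! hpos
      obtain ⟨m, hm⟩ := exists_nat_gt ((∑ j, C j) / ∑ j, a j)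
      rw [div_lt_iff₀ hpos] at hm
      have h := (Finset.sum_le_sum fun j (_ : j ∈ Finset.univ) => hC j m.succPNat).trans_lt
        (hneg m.succPNat)
      rw [Finset.sum_sub_distrib, ← Finset.sum_mul, Nat.succPNat_coe] at h
      push_cast at h
      linarith
    refine hexp.not_ge ?_
    induction p with
    | bot => exact absurd hp (not_le.mpr (EReal.bot_lt_coe 2))
    | coe r =>
      have hr : 2 ≤ r := EReal.coe_le_coe_iff.mp hp
      have hterm : ∀ j, a j * (2 - c j) = a j * (2 - r) := fun j => by
        rcases hk : idx j with _ | k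
        · have h := hc j
          rw [hk] at h
          have h' : c j = r :=
            EReal.coe_eq_coe_iff.mp (h (EReal.coe_ne_top r) (EReal.coe_ne_bot r))
          rw [h']
        · simp [ha, hk]
      rw [Finset.sum_congr rfl fun j _ => hterm j, ← Finset.sum_mul]
      exact mul_nonneg_of_nonpos_of_nonpos hA (by linarith)
    | top =>
      have hnn : ∀ j ∈ Finset.univ, 0 ≤ a j := fun j _ => by
        simp only [ha]
        split_ifs with hk
        · exact hα j (by simp [hk, adjoinP])
        · exact le_rfl
      have hz := (Finset.sum_eq_zero_iff_of_nonneg hnn).mp (hA.antisymm (Finset.sum_nonneg hnn))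
      exact (Finset.sum_eq_zero fun j hj => by rw [hz j hj, zero_mul]).ge

end
end
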